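/- arXiv:2106.06100 — 2 statements merged into one kernel-verified Lean document; each statement's English description precedes it below -/
import Mathlib

section
/- For every positive integer n and every real a ≠ 0, the generalized Rayleigh system R_a has a periodic solution, i.e. there exists a nonconstant solution (x, y) : ℝ → ℝ² and T > 0 with (x(t+T), y(t+T)) = (x(t), y(t)) for all t ∈ ℝ. -/
/-- `(x, y)` is a solution of the generalized Rayleigh system
`ẋ = y`, `ẏ = -x + a (1 - y^(2n)) y`. -/
def IsSolRayleigh (n : ℕ) (a : ℝ) (x y : ℝ → ℝ) : Prop :=
  ∀ t : ℝ, HasDerivAt x (y t) t ∧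
    HasDerivAt y (-x t + a * (1 - (y t) ^ (2 * n)) * y t) t

open Set

lemma ray_slope {g g' : ℝ → ℝ} {u v c : ℝ} (huv : u ≤ v)
    (hg : ∀ t ∈ Icc u v, HasDerivAt g (g' t) t) (hc : ∀ t ∈ Icc u v, c ≤ g' t) :
    c * (v - u) ≤ g v - g u := by
  apply (convex_Icc u v).mul_sub_le_image_sub_of_le_deriv
    (fun t ht => (hg t ht).continuousAt.continuousWithinAt)
    (fun t ht => (hg t (interior_subset ht)).differentiableAt.differentiableWithinAt)
    (fun t ht => by rw [(hg t (interior_subset ht)).deriv]; exact hc t (interior_subset ht))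
    u (left_mem_Icc.2 huv) v (right_mem_Icc.2 huv) huv

lemma ray_barrier {g g' : ℝ → ℝ} {T c : ℝ}
    (hg : ∀ t ∈ Icc 0 T, HasDerivAt g (g' t) t) (h0 : c ≤ g 0)
    (h : ∀ t ∈ Icc 0 T, g t < c → 0 ≤ g' t) : ∀ t ∈ Icc 0 T, c ≤ g t := by
  intro t1 ht1
  by_contra hlt
  push Not at hlt
  have hcont : ContinuousOn g (Icc 0 t1) := fun t ht =>
    (hg t ⟨ht.1, ht.2.trans ht1.2⟩).continuousAt.continuousWithinAt
  have hcl : IsCompact (Icc 0 t1 ∩ g ⁻¹' Ici c) :=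
    isCompact_Icc.of_isClosed_subset
      (hcont.preimage_isClosed_of_isClosed isClosed_Icc isClosed_Ici) inter_subset_left
  have hne : (Icc 0 t1 ∩ g ⁻¹' Ici c).Nonempty := ⟨0, ⟨le_rfl, ht1.1⟩, h0⟩
  obtain ⟨t0, ht0, hmax⟩ := hcl.exists_isGreatest hne
  have hlt' : ∀ t ∈ Ioc t0 t1, g t < c := by
    intro t ht
    by_contra hh
    push Not at hh
    have := hmax ⟨⟨ht0.1.1.trans ht.1.le, ht.2⟩, hh⟩
    exact absurd this (not_le.2 ht.1)
  have hle : t0 ≤ t1 := ht0.1.2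
  have := (convex_Icc t0 t1).mul_sub_le_image_sub_of_le_deriv (f := g) (C := 0)
    (hcont.mono (Icc_subset_Icc_left ht0.1.1))
    (fun t ht => (hg t ⟨ht0.1.1.trans (interior_subset ht).1,
      (interior_subset ht).2.trans ht1.2⟩).differentiableAt.differentiableWithinAt)
    (fun t ht => by
      rw [interior_Icc] at ht
      have hm : t ∈ Icc 0 T := ⟨ht0.1.1.trans ht.1.le, ht.2.le.trans ht1.2⟩
      rw [(hg t hm).deriv]; exact h t hm (hlt' t ⟨ht.1, ht.2.le⟩))
    t0 (left_mem_Icc.2 hle) t1 (right_mem_Icc.2 hle) hle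
  have h3 : c ≤ g t0 := ht0.2
  linarith

/-- clamp -/
noncomputable def rayCl (M u : ℝ) : ℝ := max (-M) (min M u)

lemma rayCl_of_mem {M u : ℝ} (h : |u| ≤ M) : rayCl M u = u := by
  rw [abs_le] at h
  rw [rayCl, min_eq_right h.2, max_eq_right h.1]

lemma rayCl_abs_le {M : ℝ} (hM : 0 ≤ M) (u : ℝ) : |rayCl M u| ≤ M := by
  rw [abs_le, rayCl]
  exact ⟨le_max_left _ _, max_le (by linarith) (min_le_left _ _)⟩

lemma rayCl_neg {M : ℝ} (hM : 0 ≤ M) (u : ℝ) : rayCl M (-u) = -rayCl M u := by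
  unfold rayCl
  grind

lemma rayCl_lipschitz (M : ℝ) : LipschitzWith 1 (rayCl M) :=
  (LipschitzWith.id.const_min M).const_max (-M)

/-- truncated field -/
noncomputable def rayV (f : ℝ → ℝ) (P Y : ℝ) (q : ℝ × ℝ) : ℝ × ℝ :=
  (rayCl Y q.2, -rayCl P q.1 + f (rayCl Y q.2))

/-- solutions of truncated field -/
def RaySol (f : ℝ → ℝ) (P Y : ℝ) (x y : ℝ → ℝ) : Prop :=
  ∀ t : ℝ, HasDerivAt x (rayCl Y (y t)) t ∧
    HasDerivAt y (-rayCl P (x t) + f (rayCl Y (y t))) t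

lemma rayV_lip {f : ℝ → ℝ} (hf : ContDiff ℝ 1 f) (P : ℝ) {Y : ℝ} (hY : 0 ≤ Y) :
    ∃ K, LipschitzWith K (rayV f P Y) := by
  obtain ⟨K, hK⟩ := (hf.contDiffOn (s := Icc (-Y) Y)).exists_lipschitzOnWith one_ne_zero
    (convex_Icc _ _) isCompact_Icc
  have h2 : LipschitzWith 1 (fun q : ℝ × ℝ => rayCl Y q.2) := by
    have := (rayCl_lipschitz Y).comp (LipschitzWith.prod_snd (α := ℝ) (β := ℝ))
    rwa [mul_one] at this
  have h1 : LipschitzWith 1 (fun q : ℝ × ℝ => rayCl P q.1) := by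
    have := (rayCl_lipschitz P).comp (LipschitzWith.prod_fst (α := ℝ) (β := ℝ))
    rwa [mul_one] at this
  have h3 : LipschitzWith (K * 1) (fun q : ℝ × ℝ => f (rayCl Y q.2)) := by
    rw [← lipschitzOnWith_univ] at h2 ⊢
    exact hK.comp h2 (fun q _ => abs_le.1 (rayCl_abs_le hY q.2))
  exact ⟨_, h2.prodMk (h1.neg.add h3)⟩

lemma rayV_bdd {f : ℝ → ℝ} (hf : Continuous f) {P Y : ℝ} (hP : 0 ≤ P) (hY : 0 ≤ Y) :
    ∃ L : NNReal, ∀ q, ‖rayV f P Y q‖ ≤ L := by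
  obtain ⟨C, hC⟩ := isCompact_Icc.exists_bound_of_continuousOn (s := Icc (-Y) Y) hf.continuousOn
  have hC0 : 0 ≤ C := (norm_nonneg _).trans (hC 0 ⟨by linarith, hY⟩)
  refine ⟨⟨Y + P + C, by positivity⟩, fun q => ?_⟩
  have h2 := rayCl_abs_le hY q.2
  have h1 := rayCl_abs_le hP q.1
  have h3 := hC _ (abs_le.1 h2)
  simp only [rayV, Prod.norm_def, Real.norm_eq_abs] at *
  refine max_le ?_ ?_
  · show _ ≤ Y + P + C
    linarith
  · show _ ≤ Y + P + C
    refine (abs_add_le _ _).trans ?_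
    rw [abs_neg]; linarith

lemma raySol_iff {f : ℝ → ℝ} {P Y : ℝ} {x y : ℝ → ℝ} :
    RaySol f P Y x y ↔ ∀ t, HasDerivAt (fun t => (x t, y t)) (rayV f P Y (x t, y t)) t := by
  constructor
  · intro h t
    exact (h t).1.prodMk (h t).2
  · intro h t
    have := h t
    exact ⟨(ContinuousLinearMap.fst ℝ ℝ ℝ).hasFDerivAt.comp_hasDerivAt t this,
      (ContinuousLinearMap.snd ℝ ℝ ℝ).hasFDerivAt.comp_hasDerivAt t this⟩

lemma raySol_unique {f : ℝ → ℝ} (hf : ContDiff ℝ 1 f) {P Y : ℝ} (hY : 0 ≤ Y)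
    {x y x' y' : ℝ → ℝ} (h : RaySol f P Y x y) (h' : RaySol f P Y x' y') {t₀ : ℝ}
    (hx : x t₀ = x' t₀) (hy : y t₀ = y' t₀) (t : ℝ) : x t = x' t ∧ y t = y' t := by
  obtain ⟨K, hK⟩ := rayV_lip hf P hY
  rw [raySol_iff] at h h'
  have := ODE_solution_unique_univ (v := fun _ => rayV f P Y) (s := fun _ => univ)
    (fun t => hK.lipschitzOnWith) (fun t => ⟨h t, trivial⟩) (fun t => ⟨h' t, trivial⟩)
    (t₀ := t₀) (by simp [hx, hy])
  have := congrFun this t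
  simpa using this

lemma raySol_exists {f : ℝ → ℝ} (hf : ContDiff ℝ 1 f) {P Y : ℝ} (hP : 0 ≤ P) (hY : 0 ≤ Y)
    (x₀ y₀ : ℝ) : ∃ x y, RaySol f P Y x y ∧ x 0 = x₀ ∧ y 0 = y₀ := by
  obtain ⟨K, hK⟩ := rayV_lip hf P hY
  obtain ⟨L, hL⟩ := rayV_bdd hf.continuous hP hY
  have key : ∀ N : ℕ, ∃ α : ℝ → ℝ × ℝ, α 0 = (x₀, y₀) ∧
      ∀ t ∈ Ioo (-(N : ℝ)) N, HasDerivAt α (rayV f P Y (α t)) t := by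
    intro N
    have hN : (0:ℝ) ≤ N := N.cast_nonneg
    have hpl : IsPicardLindelof (fun _ => rayV f P Y) (tmin := -(N:ℝ)) (tmax := N)
        ⟨0, by simp⟩ (x₀, y₀) (L * N) 0 L K :=
      { lipschitzOnWith := fun t _ => hK.lipschitzOnWith
        continuousOn := fun _ _ => continuousOn_const
        norm_le := fun t _ q _ => hL q
        mul_max_le := by simp }
    obtain ⟨α, h0, hα⟩ := hpl.exists_eq_forall_mem_Icc_hasDerivWithinAt₀
    exact ⟨α, h0, fun t ht => (hα t (Ioo_subset_Icc_self ht)).hasDerivAt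
      (Icc_mem_nhds ht.1 ht.2)⟩
  choose α h0 hα using key
  have agree : ∀ M N : ℕ, 0 < M → M ≤ N → EqOn (α M) (α N) (Ioo (-(M:ℝ)) M) := by
    intro M N hM hMN
    have hM' : (0:ℝ) < M := by exact_mod_cast hM
    have hMN' : (M:ℝ) ≤ N := by exact_mod_cast hMN
    exact ODE_solution_unique_of_mem_Ioo (v := fun _ => rayV f P Y) (s := fun _ => univ)
      (K := K) (t₀ := 0) (fun t _ => hK.lipschitzOnWith) ⟨by linarith, hM'⟩
      (fun t ht => ⟨hα M t ht, trivial⟩)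
      (fun t ht => ⟨hα N t ⟨by linarith [ht.1], by linarith [ht.2]⟩, trivial⟩)
      (by rw [h0, h0])
  let γ : ℝ → ℝ × ℝ := fun t => α (⌈|t|⌉₊ + 1) t
  have hγ : ∀ N : ℕ, ∀ t ∈ Ioo (-(N:ℝ)) N, γ t = α N t := by
    intro N t ht
    have hlt : |t| < N := abs_lt.2 ht
    have hc : ⌈|t|⌉₊ ≤ N := Nat.ceil_le.2 hlt.le
    have hc1 : t ∈ Ioo (-((⌈|t|⌉₊ + 1 : ℕ):ℝ)) (⌈|t|⌉₊ + 1 : ℕ) := by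
      rw [mem_Ioo, ← abs_lt]
      push_cast
      linarith [Nat.le_ceil |t|]
    have hNpos : 0 < N := by
      have : (0:ℝ) < N := (abs_nonneg t).trans_lt hlt
      exact_mod_cast this
    rcases le_total (⌈|t|⌉₊ + 1) N with h | h
    · exact agree _ _ (Nat.succ_pos _) h hc1
    · exact (agree _ _ hNpos h ht).symm
  have hsol : ∀ t, HasDerivAt γ (rayV f P Y (γ t)) t := by
    intro t
    obtain ⟨N, hN⟩ := exists_nat_gt |t|
    have ht := abs_lt.1 hN
    rw [hγ N t ht]
    refine (hα N t ht).congr_of_eventuallyEq ?_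
    filter_upwards [Ioo_mem_nhds ht.1 ht.2] with u hu using hγ N u hu
  refine ⟨fun t => (γ t).1, fun t => (γ t).2, raySol_iff.2 hsol, ?_, ?_⟩
  · simp [γ, h0]
  · simp [γ, h0]

lemma raySol_shift {f : ℝ → ℝ} {P Y : ℝ} {x y : ℝ → ℝ} (h : RaySol f P Y x y) (c : ℝ) :
    RaySol f P Y (fun t => x (t + c)) (fun t => y (t + c)) := fun t =>
  ⟨(h (t + c)).1.comp_add_const t c, (h (t + c)).2.comp_add_const t c⟩

lemma raySol_neg {f : ℝ → ℝ} (hf : ∀ u, f (-u) = -f u) {P Y : ℝ} (hP : 0 ≤ P) (hY : 0 ≤ Y)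
    {x y : ℝ → ℝ} (h : RaySol f P Y x y) :
    RaySol f P Y (fun t => -x t) (fun t => -y t) := fun t => by
  rw [rayCl_neg hY, rayCl_neg hP, hf]
  refine ⟨(h t).1.neg, ?_⟩
  convert! (h t).2.neg using 1
  ring

/-- the nonlinearity -/
noncomputable def rayF (n : ℕ) (a u : ℝ) : ℝ := a * (1 - u ^ (2 * n)) * u

lemma rayF_contDiff (n : ℕ) (a : ℝ) : ContDiff ℝ 1 (rayF n a) := by
  unfold rayF; fun_prop

lemma rayF_neg (n : ℕ) (a u : ℝ) : rayF n a (-u) = -rayF n a u := by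
  unfold rayF
  rw [pow_mul, neg_sq, ← pow_mul]; ring

lemma rayF_le_mul (n : ℕ) {a u : ℝ} (ha : 0 < a) (hu : 0 ≤ u) : rayF n a u ≤ a * u := by
  unfold rayF
  have : 0 ≤ a * u * u ^ (2 * n) := by positivity
  linarith

lemma rayF_le (n : ℕ) {a u : ℝ} (ha : 0 < a) (hu : 0 ≤ u) : rayF n a u ≤ a := by
  rcases le_total u 1 with h | h
  · exact (rayF_le_mul n ha hu).trans (by nlinarith)
  · unfold rayF
    have h1 : 1 ≤ u ^ (2 * n) := one_le_pow₀ h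
    have : 0 ≤ a * u * (u ^ (2 * n) - 1) :=
      mul_nonneg (by positivity) (by linarith)
    linarith

lemma rayF_nonneg (n : ℕ) {a u : ℝ} (ha : 0 < a) (hu : 0 ≤ u) (h1 : u ≤ 1) :
    0 ≤ rayF n a u := by
  unfold rayF
  have h1 : u ^ (2 * n) ≤ 1 := pow_le_one₀ hu h1
  exact mul_nonneg (mul_nonneg ha.le (by linarith)) hu

lemma rayF_ge (n : ℕ) {a u Y : ℝ} (ha : 0 < a) (hu : 0 ≤ u) (h1 : u ≤ Y) :
    -(a * Y ^ (2 * n)) * u ≤ rayF n a u := by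
  unfold rayF
  have h1 : u ^ (2 * n) ≤ Y ^ (2 * n) := pow_le_pow_left₀ hu h1 _
  have : 0 ≤ a * u * (Y ^ (2 * n) - u ^ (2 * n)) :=
      mul_nonneg (by positivity) (by linarith)
  have : 0 ≤ a * u := by positivity
  linarith

lemma ray_params {n : ℕ} (hn : 0 < n) {a : ℝ} (ha : 0 < a) :
    ∃ Y, 2 ≤ Y ∧ rayF n a Y ≤ -(2 * a + Y + 1) := by
  have hi : 0 < 1 / a := by positivity
  have hai : a * (1 / a) = 1 := by field_simp
  refine ⟨2 + 1 / a, by linarith, ?_⟩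
  set b := 1 / a
  unfold rayF
  have h1 : (2 + b) ^ 2 ≤ (2 + b) ^ (2 * n) :=
    pow_le_pow_right₀ (by linarith) (by omega)
  have h2 : a * (2 + b) * ((2 + b) ^ 2) ≤ a * (2 + b) * ((2 + b) ^ (2 * n)) :=
    mul_le_mul_of_nonneg_left h1 (by positivity)
  have h3 : a * (1 - (2 + b) ^ 2) * (2 + b) ≤ -(2 * a + (2 + b) + 1) := by
    have e : a * (1 - (2 + b) ^ 2) * (2 + b)
      = -6 * a - 11 * (a * b) - 6 * (a * b) * b - (a * b) * b ^ 2 := by ring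
    rw [e, hai]
    nlinarith
  linarith

section
variable {n : ℕ} {a Y P s : ℝ} {x y : ℝ → ℝ}

lemma ray_arc_facts (ha : 0 < a) (hY : 2 ≤ Y) (hP : P = 2 * a + Y + 1)
    (hF : rayF n a Y ≤ -P) (h : RaySol (rayF n a) P Y x y) (hx0 : x 0 = -s) (hy0 : y 0 = 0)
    (hs1 : 1 ≤ s) (hsP : s ≤ P) {T : ℝ} (hpos : ∀ t ∈ Icc 0 T, 0 ≤ y t) :
    ∀ t ∈ Icc 0 T, -P ≤ x t ∧ x t ≤ P ∧ y t ≤ Y ∧ 1 ≤ x t ^ 2 + y t ^ 2 := by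
  have hP0 : 0 ≤ P := by linarith
  -- y ≤ Y
  have hyY : ∀ t ∈ Icc 0 T, y t ≤ Y := by
    have := ray_barrier (g := fun t => -y t) (T := T) (c := -Y)
      (fun t _ => (h t).2.neg) (by simp only [hy0]; linarith) (fun t _ hlt => by
        have hh : Y < y t := by linarith
        have e : rayCl Y (y t) = Y := by
          unfold rayCl; rw [min_eq_left hh.le, max_eq_right (by linarith)]
        rw [e]
        have := (abs_le.1 (rayCl_abs_le hP0 (x t))).1
        linarith)
    intro t ht
    have := this t ht
    linarith
  have hycl : ∀ t ∈ Icc 0 T, rayCl Y (y t) = y t := fun t ht =>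
    rayCl_of_mem (abs_le.2 ⟨by linarith [hpos t ht], hyY t ht⟩)
  have hmono : ∀ u v, 0 ≤ u → u ≤ v → v ≤ T → x u ≤ x v := by
    intro u v hu huv hv
    have := ray_slope (g := x) (c := 0) huv (fun t _ => (h t).1) (fun t ht => by
      have ht' : t ∈ Icc 0 T := ⟨hu.trans ht.1, ht.2.trans hv⟩
      rw [hycl t ht']; exact hpos t ht')
    linarith
  have hxlow : ∀ t ∈ Icc 0 T, -P ≤ x t := fun t ht => by
    have := hmono 0 t le_rfl ht.1 ht.2
    linarith
  have hxc : Continuous x := continuous_iff_continuousAt.2 fun t => (h t).1.continuousAt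
  have hxP : ∀ t ∈ Icc 0 T, x t ≤ P := by
    intro t1 ht1
    by_contra hlt
    push Not at hlt
    obtain ⟨t0, ht0, hxt0⟩ := intermediate_value_Icc ht1.1 hxc.continuousOn
      (show P ∈ Icc (x 0) (x t1) from ⟨by linarith, hlt.le⟩)
    obtain ⟨tz, htz, hxtz⟩ := intermediate_value_Icc ht0.1 hxc.continuousOn
      (show (0:ℝ) ∈ Icc (x 0) (x t0) from ⟨by linarith, by linarith⟩)
    have hsl := ray_slope (g := fun t => -(x t ^ 2 + y t ^ 2 - 2 * a * x t)) (c := 0) htz.2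
      (fun t _ => (((((h t).1.pow 2).add ((h t).2.pow 2)).sub ((h t).1.const_mul (2 * a)))).neg)
      (fun t ht => by
        have ht' : t ∈ Icc 0 T := ⟨htz.1.trans ht.1, ht.2.trans (ht0.2.trans ht1.2)⟩
        have hxle : x t ≤ P := by
          rw [← hxt0]; exact hmono _ _ ht'.1 ht.2 (ht0.2.trans ht1.2)
        rw [hycl t ht', rayCl_of_mem (abs_le.2 ⟨hxlow t ht', hxle⟩)]
        have h1 := rayF_le n ha (hpos t ht')
        have h2 := mul_le_mul_of_nonneg_left h1 (hpos t ht')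
        simp only [Nat.cast_ofNat, Nat.add_one_sub_one, pow_one]
        linarith)
    simp only [hxt0, hxtz] at hsl
    have h3 := hyY tz ⟨htz.1, htz.2.trans (ht0.2.trans ht1.2)⟩
    have h4 := hpos tz ⟨htz.1, htz.2.trans (ht0.2.trans ht1.2)⟩
    have h5 : y tz ^ 2 ≤ Y ^ 2 := pow_le_pow_left₀ h4 h3 2
    have h6 : P ^ 2 - 2 * a * P = P * (Y + 1) := by rw [hP]; ring
    have h7 := sq_nonneg (y t0)
    nlinarith
  have hE : ∀ t ∈ Icc 0 T, 1 ≤ x t ^ 2 + y t ^ 2 := by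
    refine ray_barrier (fun t _ => ((h t).1.pow 2).add ((h t).2.pow 2)) ?_ ?_
    · rw [hx0, hy0]; nlinarith
    · intro t ht hlt
      rw [hycl t ht, rayCl_of_mem (abs_le.2 ⟨hxlow t ht, hxP t ht⟩)]
      have hlt' : x t ^ 2 + y t ^ 2 < 1 := hlt
      have h0 := hpos t ht
      have h1 : y t ≤ 1 := by nlinarith [sq_nonneg (x t)]
      have h2 := mul_nonneg h0 (rayF_nonneg n ha h0 h1)
      simp only [Nat.cast_ofNat, Nat.add_one_sub_one, pow_one]
      linarith
  exact fun t ht => ⟨hxlow t ht, hxP t ht, hyY t ht, hE t ht⟩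

lemma ray_arc_time (ha : 0 < a) (hY : 2 ≤ Y) (hP : P = 2 * a + Y + 1)
    (hF : rayF n a Y ≤ -P) (h : RaySol (rayF n a) P Y x y) (hx0 : x 0 = -s) (hy0 : y 0 = 0)
    (hs1 : 1 ≤ s) (hsP : s ≤ P) : ∃ C : ℝ, ∀ T : ℝ, (∀ t ∈ Icc 0 T, 0 ≤ y t) → T ≤ C := by
  have hK : 2 ≤ 2 + a * Y ^ (2 * n) := by
    have : 0 ≤ a * Y ^ (2 * n) := by positivity
    linarith
  obtain ⟨K, hKdef⟩ : ∃ K, K = 2 + a * Y ^ (2 * n) := ⟨_, rfl⟩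
  rw [← hKdef] at hK
  have hP0 : 0 ≤ P := by linarith
  obtain ⟨C1, hC1⟩ : ∃ C1, C1 = 2 * (K / 2 + Y + K * P) + 1 := ⟨_, rfl⟩
  have hC10 : 0 ≤ C1 := by rw [hC1]; positivity
  refine ⟨C1 + 2 * (Y + 2 * (a * P)), fun T hpos => ?_⟩
  by_contra hT
  push Not at hT
  have haP : 0 ≤ a * P := by positivity
  have hCT : C1 ≤ T := by linarith
  have facts := ray_arc_facts ha hY hP hF h hx0 hy0 hs1 hsP hpos
  have hycl : ∀ t ∈ Icc 0 T, rayCl Y (y t) = y t := fun t ht =>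
    rayCl_of_mem (abs_le.2 ⟨by linarith [hpos t ht], (facts t ht).2.2.1⟩)
  have hxcl : ∀ t ∈ Icc 0 T, rayCl P (x t) = x t := fun t ht =>
    rayCl_of_mem (abs_le.2 ⟨(facts t ht).1, (facts t ht).2.1⟩)
  have hmono : ∀ u v, 0 ≤ u → u ≤ v → v ≤ T → x u ≤ x v := by
    intro u v hu huv hv
    have := ray_slope (g := x) (c := 0) huv (fun t _ => (h t).1) (fun t ht => by
      have ht' : t ∈ Icc 0 T := ⟨hu.trans ht.1, ht.2.trans hv⟩
      rw [hycl t ht']; exact hpos t ht')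
    linarith
  have hC1m : C1 ∈ Icc 0 T := ⟨hC10, hCT⟩
  have hTm : T ∈ Icc 0 T := ⟨hC10.trans hCT, le_rfl⟩
  have hhalf : 1 / 2 ≤ x C1 := by
    by_contra hlt
    push Not at hlt
    have hsl := ray_slope (g := fun t => K * x t + y t) (c := 1 / 2) hC10
      (fun t _ => ((h t).1.const_mul K).add (h t).2)
      (fun t ht => by
        have ht' : t ∈ Icc 0 T := ⟨ht.1, ht.2.trans hCT⟩
        have hx : x t ≤ 1 / 2 := (hmono _ _ ht.1 ht.2 hCT).trans hlt.le
        obtain ⟨-, -, f3, f4⟩ := facts t ht'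
        have hy := hpos t ht'
        rw [hycl t ht', hxcl t ht']
        have h1 := rayF_ge n ha hy f3
        have h2 : 2 * y t - x t ≤ K * y t + (-x t + rayF n a (y t)) := by
          rw [hKdef]; linarith
        refine le_trans ?_ h2
        rcases le_total (x t) (-(1 / 2)) with hx2 | hx2
        · linarith
        · have : x t ^ 2 ≤ 1 / 4 := by nlinarith
          nlinarith)
    have f0 := (facts C1 hC1m).2.2.1
    simp only [hx0, hy0] at hsl
    have : K * x C1 ≤ K * (1 / 2) := mul_le_mul_of_nonneg_left hlt.le (by linarith)
    have : K * s ≤ K * P := mul_le_mul_of_nonneg_left hsP (by linarith)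
    linarith
  have hsl := ray_slope (g := fun t => a * x t - y t) (c := 1 / 2) hCT
    (fun t _ => ((h t).1.const_mul a).sub (h t).2)
    (fun t ht => by
      have ht' : t ∈ Icc 0 T := ⟨hC10.trans ht.1, ht.2⟩
      have hx : 1 / 2 ≤ x t := hhalf.trans (hmono _ _ hC10 ht.1 ht.2)
      rw [hycl t ht', hxcl t ht']
      have h1 := rayF_le_mul n ha (hpos t ht')
      linarith)
  have f1 := facts C1 hC1m
  have f2 := facts T hTm
  have f3 := hpos T hTm
  have : a * x T ≤ a * P := mul_le_mul_of_nonneg_left f2.2.1 ha.le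
  have : a * (-P) ≤ a * x C1 := mul_le_mul_of_nonneg_left f1.1 ha.le
  linarith [f1.2.2.1]

lemma ray_arc (ha : 0 < a) (hY : 2 ≤ Y) (hP : P = 2 * a + Y + 1)
    (hF : rayF n a Y ≤ -P) (h : RaySol (rayF n a) P Y x y) (hx0 : x 0 = -s) (hy0 : y 0 = 0)
    (hs1 : 1 ≤ s) (hsP : s ≤ P) :
    ∃ τ, 0 < τ ∧ (∀ t ∈ Ioo 0 τ, 0 < y t) ∧ y τ = 0 ∧ 1 ≤ x τ ∧
      ∀ t ∈ Icc 0 τ, |x t| ≤ P ∧ |y t| ≤ Y := by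
  have hP0 : 0 ≤ P := by linarith
  have hf0 : rayF n a 0 = 0 := by simp [rayF]
  have hyc : Continuous y := continuous_iff_continuousAt.2 fun t => (h t).2.continuousAt
  have hd0 : HasDerivAt y s 0 := by
    have := (h 0).2
    rwa [hx0, hy0, rayCl_of_mem (u := 0) (by simp; linarith), hf0,
      rayCl_of_mem (u := -s) (by rw [abs_neg, abs_of_pos (by linarith)]; exact hsP), neg_neg,
      add_zero] at this
  obtain ⟨ε, hε, hεpos⟩ : ∃ ε > 0, ∀ t ∈ Ioc 0 ε, 0 < y t := by
    have h1 : ∀ᶠ t in nhdsWithin 0 {0}ᶜ, 0 < slope y 0 t :=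
      (hasDerivAt_iff_tendsto_slope.1 hd0).eventually (lt_mem_nhds (by linarith))
    have h2 : ∀ᶠ t in nhdsWithin (0:ℝ) (Ioi 0), 0 < slope y 0 t :=
      h1.filter_mono (nhdsWithin_mono _ (fun t ht => (ne_of_gt ht)))
    obtain ⟨u, hu, hu2⟩ := mem_nhdsGT_iff_exists_Ioc_subset.1 h2
    refine ⟨u, hu, fun t ht => ?_⟩
    have h3 : 0 < slope y 0 t := hu2 ht
    rw [slope_def_field, hy0, sub_zero, sub_zero] at h3
    exact (div_pos_iff_of_pos_right ht.1).1 h3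
  obtain ⟨C, hC⟩ := ray_arc_time ha hY hP hF h hx0 hy0 hs1 hsP
  obtain ⟨S, hS⟩ : ∃ S : Set ℝ, S = Ici ε ∩ y ⁻¹' Iic 0 := ⟨_, rfl⟩
  have hScl : IsClosed S := by
    rw [hS]; exact isClosed_Ici.inter (isClosed_Iic.preimage hyc)
  have hSne : S.Nonempty := by
    by_contra hne
    rw [not_nonempty_iff_eq_empty] at hne
    have := hC (C + 1) (fun t ht => by
      by_contra hlt
      push Not at hlt
      have hte : ε ≤ t := by
        by_contra hte
        push Not at hte
        rcases ht.1.eq_or_lt with h0 | h0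
        · rw [← h0, hy0] at hlt; exact lt_irrefl _ hlt
        · exact absurd (hεpos t ⟨h0, hte.le⟩) (not_lt.2 hlt.le)
      have : t ∈ S := by rw [hS]; exact ⟨hte, hlt.le⟩
      rw [hne] at this; exact this)
    linarith
  have hSb : BddBelow S := ⟨ε, fun t ht => by rw [hS] at ht; exact ht.1⟩
  obtain ⟨τ, hτ⟩ : ∃ τ, τ = sInf S := ⟨_, rfl⟩
  have hτS : τ ∈ S := hτ ▸ hScl.csInf_mem hSne hSb
  have hτε : ε ≤ τ := by rw [hS] at hτS; exact hτS.1
  have hτy : y τ ≤ 0 := by rw [hS] at hτS; exact hτS.2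
  have hτ0 : 0 < τ := by linarith
  have hpos : ∀ t ∈ Ioo 0 τ, 0 < y t := by
    intro t ht
    rcases le_total t ε with hte | hte
    · exact hεpos t ⟨ht.1, hte⟩
    · by_contra hlt
      push Not at hlt
      have : t ∈ S := by rw [hS]; exact ⟨hte, hlt⟩
      have := csInf_le hSb this
      rw [← hτ] at this
      linarith [ht.2]
  have hnn : ∀ t ∈ Icc 0 τ, 0 ≤ y t := by
    have : closure (Ioo 0 τ) ⊆ y ⁻¹' Ici 0 :=
      closure_minimal (fun t ht => (hpos t ht).le) (isClosed_Ici.preimage hyc)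
    rw [closure_Ioo hτ0.ne] at this
    exact this
  have hyτ : y τ = 0 := le_antisymm hτy (hnn τ ⟨hτ0.le, le_rfl⟩)
  have facts := ray_arc_facts ha hY hP hF h hx0 hy0 hs1 hsP hnn
  have habs : ∀ t ∈ Icc 0 τ, |x t| ≤ P ∧ |y t| ≤ Y := fun t ht =>
    ⟨abs_le.2 ⟨(facts t ht).1, (facts t ht).2.1⟩,
      abs_le.2 ⟨by linarith [hnn t ht], (facts t ht).2.2.1⟩⟩
  refine ⟨τ, hτ0, hpos, hyτ, ?_, habs⟩
  have hτm : τ ∈ Icc 0 τ := ⟨hτ0.le, le_rfl⟩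
  have hE := (facts τ hτm).2.2.2
  rw [hyτ] at hE
  have hx : 0 ≤ x τ := by
    by_contra hlt
    push Not at hlt
    have hd : HasDerivAt y (-x τ) τ := by
      have := (h τ).2
      rwa [hyτ, rayCl_of_mem (u := 0) (by simp; linarith), hf0, rayCl_of_mem (habs τ hτm).1,
        add_zero] at this
    have h1 : ∀ᶠ t in nhdsWithin τ {τ}ᶜ, 0 < slope y τ t :=
      (hasDerivAt_iff_tendsto_slope.1 hd).eventually (lt_mem_nhds (by linarith))
    have h2 : ∀ᶠ t in nhdsWithin τ (Iio τ), 0 < slope y τ t :=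
      h1.filter_mono (nhdsWithin_mono _ (fun t ht => (ne_of_lt ht)))
    have h3 : ∀ᶠ t in nhdsWithin τ (Iio τ), t ∈ Ioo 0 τ := Ioo_mem_nhdsLT hτ0
    obtain ⟨t, ht2, ht3⟩ := (h2.and h3).exists
    rw [slope_def_field, hyτ, sub_zero] at ht2
    have := div_neg_of_pos_of_neg (hpos t ht3) (sub_neg.2 ht3.2)
    linarith
  nlinarith
end

/-- an arc of the truncated system in the upper half plane -/
def RayArc (n : ℕ) (a P Y s : ℝ) (x y : ℝ → ℝ) (τ : ℝ) : Prop :=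
  RaySol (rayF n a) P Y x y ∧ x 0 = -s ∧ y 0 = 0 ∧ 0 < τ ∧ (∀ t ∈ Ioo 0 τ, 0 < y t) ∧
    y τ = 0 ∧ 1 ≤ x τ ∧ ∀ t ∈ Icc 0 τ, |x t| ≤ P ∧ |y t| ≤ Y

lemma RayArc.strictMono {n : ℕ} {a P Y s τ : ℝ} {x y : ℝ → ℝ} (h : RayArc n a P Y s x y τ) :
    StrictMonoOn x (Icc 0 τ) := by
  obtain ⟨hsol, -, -, -, hpos, -, -, hb⟩ := h
  refine strictMonoOn_of_deriv_pos (convex_Icc _ _)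
    (fun t _ => (hsol t).1.continuousAt.continuousWithinAt) (fun t ht => ?_)
  rw [interior_Icc] at ht
  rw [(hsol t).1.deriv, rayCl_of_mem (hb t (Ioo_subset_Icc_self ht)).2]
  exact hpos t ht

lemma RayArc.nonneg {n : ℕ} {a P Y s τ : ℝ} {x y : ℝ → ℝ} (h : RayArc n a P Y s x y τ) :
    ∀ t ∈ Icc 0 τ, 0 ≤ y t := by
  obtain ⟨-, -, h0, -, hpos, h1, -, -⟩ := h
  intro t ht
  rcases ht.1.eq_or_lt with e | e
  · rw [← e, h0]
  rcases ht.2.eq_or_lt with e2 | e2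
  · rw [e2, h1]
  · exact (hpos t ⟨e, e2⟩).le

lemma RayArc.mono {n : ℕ} {a P Y s τ s' τ' : ℝ} {x y x' y' : ℝ → ℝ} (hY : 0 ≤ Y)
    (h : RayArc n a P Y s x y τ) (h' : RayArc n a P Y s' x' y' τ') (hs1 : 1 ≤ s)
    (hss : s < s') : x τ ≤ x' τ' := by
  by_contra hlt
  push Not at hlt
  have hm := h.strictMono
  have hm' := h'.strictMono
  have hnn' := h'.nonneg
  have hnn := h.nonneg
  obtain ⟨hsol, hx0, hy0, hτ, hpos, hyτ, hxτ, -⟩ := h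
  obtain ⟨hsol', hx0', hy0', hτ', hpos', hyτ', hxτ', -⟩ := h'
  have hxc : Continuous x := continuous_iff_continuousAt.2 fun t => (hsol t).1.continuousAt
  have hyc : Continuous y := continuous_iff_continuousAt.2 fun t => (hsol t).2.continuousAt
  have hxc' : Continuous x' := continuous_iff_continuousAt.2 fun t => (hsol' t).1.continuousAt
  have hyc' : Continuous y' := continuous_iff_continuousAt.2 fun t => (hsol' t).2.continuousAt
  obtain ⟨tb, htb, hxtb⟩ := intermediate_value_Icc hτ.le hxc.continuousOn
    (show x' τ' ∈ Icc (x 0) (x τ) from ⟨by linarith, hlt.le⟩)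
  have htbτ : tb < τ := by
    rcases htb.2.eq_or_lt with e | e
    · rw [e] at hxtb; linarith
    · exact e
  -- existence of a matching time
  have hmatch : ∀ t ∈ Icc 0 tb, ∃ u ∈ Icc 0 τ', x' u = x t := by
    intro t ht
    have h1 : x t ≤ x' τ' := by
      rw [← hxtb]; exact hm.monotoneOn ⟨ht.1, ht.2.trans htb.2⟩ htb ht.2
    have h2 : x 0 ≤ x t :=
      hm.monotoneOn ⟨le_rfl, hτ.le⟩ ⟨ht.1, ht.2.trans htb.2⟩ ht.1
    exact intermediate_value_Icc hτ'.le hxc'.continuousOn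
      (show x t ∈ Icc (x' 0) (x' τ') from ⟨by linarith, h1⟩)
  have hA : IsClosed (Prod.fst '' ((Icc 0 tb ×ˢ Icc 0 τ') ∩
      {q : ℝ × ℝ | x' q.2 = x q.1 ∧ y q.1 ≤ y' q.2})) := by
    refine IsCompact.isClosed (IsCompact.image ?_ continuous_fst)
    exact (isCompact_Icc.prod isCompact_Icc).inter_right
      ((isClosed_eq (hxc'.comp continuous_snd) (hxc.comp continuous_fst)).inter
        (isClosed_le (hyc.comp continuous_fst) (hyc'.comp continuous_snd)))
  have hB : IsClosed (Prod.fst '' ((Icc 0 tb ×ˢ Icc 0 τ') ∩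
      {q : ℝ × ℝ | x' q.2 = x q.1 ∧ y' q.2 ≤ y q.1})) := by
    refine IsCompact.isClosed (IsCompact.image ?_ continuous_fst)
    exact (isCompact_Icc.prod isCompact_Icc).inter_right
      ((isClosed_eq (hxc'.comp continuous_snd) (hxc.comp continuous_fst)).inter
        (isClosed_le (hyc'.comp continuous_snd) (hyc.comp continuous_fst)))
  obtain ⟨t, -, ⟨⟨t1, u1⟩, ⟨hm1, hu1, hv1⟩, rfl⟩, ⟨⟨t2, u2⟩, ⟨hm2, hu2, hv2⟩, e2⟩⟩ :=
    isPreconnected_closed_iff.1 (isPreconnected_Icc (a := (0:ℝ)) (b := tb)) _ _ hA hB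
    (by
      intro t ht
      obtain ⟨u, hu, hxu⟩ := hmatch t ht
      rcases le_total (y t) (y' u) with hle | hle
      · exact Or.inl ⟨(t, u), ⟨⟨ht, hu⟩, hxu, hle⟩, rfl⟩
      · exact Or.inr ⟨(t, u), ⟨⟨ht, hu⟩, hxu, hle⟩, rfl⟩)
    (by
      have ht : (0:ℝ) ∈ Icc 0 tb := ⟨le_rfl, htb.1⟩
      obtain ⟨u, hu, hxu⟩ := hmatch 0 ht
      exact ⟨0, ht, (0, u), ⟨⟨ht, hu⟩, hxu, by rw [hy0]; exact hnn' u hu⟩, rfl⟩)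
    (⟨tb, ⟨htb.1, le_rfl⟩, (tb, τ'), ⟨⟨⟨htb.1, le_rfl⟩, ⟨hτ'.le, le_rfl⟩⟩, hxtb.symm,
      by simp only [hyτ']; exact hnn tb htb⟩, rfl⟩)
  simp only at e2 hu1 hu2 hv1 hv2 hm1 hm2
  subst e2
  have hu : u1 = u2 := hm'.injOn hm1.2 hm2.2 (hu1.trans hu2.symm)
  subst hu
  have hye : y t2 = y' u1 := le_antisymm hv1 hv2
  have huniq := raySol_unique (rayF_contDiff n a) hY (raySol_shift hsol t2)
    (raySol_shift hsol' u1) (t₀ := 0) (by simp [hu1]) (by simp [hye])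
  obtain ⟨⟨ht0, htb'⟩, ⟨hu0, huτ⟩⟩ := hm1
  simp only at ht0 htb' hu0 huτ
  rcases le_or_gt t2 u1 with hle | hgt
  · obtain ⟨e1, e2⟩ := huniq (-t2)
    rw [neg_add_cancel, neg_add_eq_sub, hx0] at e1
    rw [neg_add_cancel, neg_add_eq_sub, hy0] at e2
    rcases (sub_nonneg.2 hle).eq_or_lt with h0 | h0
    · rw [← h0, hx0'] at e1; linarith
    rcases (show u1 - t2 ≤ τ' by linarith).eq_or_lt with h1 | h1
    · rw [h1] at e1; linarith
    · have := hpos' _ ⟨h0, h1⟩; linarith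
  · obtain ⟨e1, e2⟩ := huniq (-u1)
    rw [neg_add_cancel, neg_add_eq_sub, hy0'] at e2
    have := hpos _ ⟨sub_pos.2 hgt, show t2 - u1 < τ by linarith⟩
    linarith

lemma ray_pos {n : ℕ} (hn : 0 < n) {a : ℝ} (ha : 0 < a) :
    ∃ (x y : ℝ → ℝ) (T : ℝ),
      IsSolRayleigh n a x y ∧
      (∃ t₁ t₂ : ℝ, (x t₁, y t₁) ≠ (x t₂, y t₂)) ∧
      0 < T ∧
      ∀ t : ℝ, (x (t + T), y (t + T)) = (x t, y t) := by
  obtain ⟨Y, hY, hF⟩ := ray_params hn ha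
  obtain ⟨P, hP⟩ : ∃ P, P = 2 * a + Y + 1 := ⟨_, rfl⟩
  rw [← hP] at hF
  have hY0 : 0 ≤ Y := by linarith
  have hP0 : 0 ≤ P := by linarith
  have key : ∀ s, ∃ x y τ, 1 ≤ s → s ≤ P → RayArc n a P Y s x y τ := by
    intro s
    obtain ⟨x, y, hsol, hx0, hy0⟩ := raySol_exists (rayF_contDiff n a) hP0 hY0 (-s) 0
    by_cases hs : 1 ≤ s ∧ s ≤ P
    · obtain ⟨τ, h⟩ := ray_arc ha hY hP hF hsol hx0 hy0 hs.1 hs.2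
      exact ⟨x, y, τ, fun _ _ => ⟨hsol, hx0, hy0, h⟩⟩
    · exact ⟨x, y, 0, fun h1 h2 => absurd ⟨h1, h2⟩ hs⟩
  choose X Z τ hArc using key
  obtain ⟨H, hH⟩ : ∃ H : ℝ → ℝ, ∀ s, H s = X s (τ s) := ⟨fun s => X s (τ s), fun _ => rfl⟩
  have hH1 : ∀ s, 1 ≤ s → s ≤ P → 1 ≤ H s := fun s h1 h2 => by
    obtain ⟨-, -, -, -, -, -, h, -⟩ := hArc s h1 h2
    rw [hH]; exact h
  have hH2 : ∀ s, 1 ≤ s → s ≤ P → H s ≤ P := fun s h1 h2 => by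
    obtain ⟨-, -, -, hτ, -, -, -, h⟩ := hArc s h1 h2
    rw [hH]; exact (abs_le.1 (h _ ⟨hτ.le, le_rfl⟩).1).2
  have hHm : ∀ s s', 1 ≤ s → s ≤ s' → s' ≤ P → H s ≤ H s' := by
    intro s s' h1 h2 h3
    rcases h2.eq_or_lt with e | e
    · rw [e]
    · rw [hH, hH]
      exact (hArc s h1 (h2.trans h3)).mono hY0 (hArc s' (h1.trans h2) h3) h1 e
  obtain ⟨S, hS⟩ : ∃ S : Set ℝ, ∀ s, s ∈ S ↔ (1 ≤ s ∧ s ≤ P ∧ s ≤ H s) :=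
    ⟨{s | 1 ≤ s ∧ s ≤ P ∧ s ≤ H s}, fun _ => Iff.rfl⟩
  have h1S : (1:ℝ) ∈ S := (hS 1).2 ⟨le_rfl, by linarith, hH1 1 le_rfl (by linarith)⟩
  have hSb : BddAbove S := ⟨P, fun s hs => ((hS s).1 hs).2.1⟩
  obtain ⟨c, hc⟩ : ∃ c, c = sSup S := ⟨_, rfl⟩
  have hcge : ∀ s ∈ S, s ≤ c := fun s hs => hc ▸ le_csSup hSb hs
  have hc1 : 1 ≤ c := hcge 1 h1S
  have hcP : c ≤ P := hc ▸ csSup_le ⟨1, h1S⟩ (fun s hs => ((hS s).1 hs).2.1)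
  have hcH : c ≤ H c := by
    have : sSup S ≤ H c := csSup_le ⟨1, h1S⟩ (fun s hs => by
      obtain ⟨g1, g2, g3⟩ := (hS s).1 hs
      exact g3.trans (hHm s c g1 (hcge s hs) hcP))
    rwa [← hc] at this
  have hHc : H c ≤ c := hcge _ ((hS _).2 ⟨hH1 c hc1 hcP, hH2 c hc1 hcP,
    hHm _ _ hc1 hcH (hH2 c hc1 hcP)⟩)
  have hfix : H c = c := le_antisymm hHc hcH
  rw [hH] at hfix
  obtain ⟨hsol, hx0, hy0, hτ, -, hyτ, -, hb⟩ := hArc c hc1 hcP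
  set x := X c
  set y := Z c
  set T := τ c
  have hanti := raySol_unique (rayF_contDiff n a) hY0 (t₀ := 0) hsol
    (raySol_neg (rayF_neg n a) hP0 hY0 (raySol_shift hsol T))
    (by simp [hx0, hfix]) (by simp [hy0, hyτ])
  have hbox : ∀ t, |x t| ≤ P ∧ |y t| ≤ Y := by
    intro t
    have hper : Function.Periodic (fun t => (|x t|, |y t|)) T := fun t => by
      obtain ⟨e1, e2⟩ := hanti t
      simp only [e1, e2, abs_neg]
    obtain ⟨r, hr, e⟩ := hper.exists_mem_Ico₀ hτ t
    simp only [Prod.mk.injEq] at e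
    rw [e.1, e.2]
    exact hb r (Ico_subset_Icc_self hr)
  refine ⟨x, y, T + T, fun t => ?_, ⟨0, T, ?_⟩, by linarith, fun t => ?_⟩
  · have := hsol t
    rwa [rayCl_of_mem (hbox t).1, rayCl_of_mem (hbox t).2] at this
  · intro e
    have := congrArg Prod.fst e
    simp only [hx0, hfix] at this
    linarith
  · obtain ⟨e1, e2⟩ := hanti t
    obtain ⟨e3, e4⟩ := hanti (t + T)
    rw [← add_assoc]
    simp only [e1, e2, e3, e4, neg_neg]

theorem rayleigh_has_periodic_solution (n : ℕ) (hn : 0 < n) (a : ℝ) (ha : a ≠ 0) :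
    ∃ (x y : ℝ → ℝ) (T : ℝ),
      IsSolRayleigh n a x y ∧
      (∃ t₁ t₂ : ℝ, (x t₁, y t₁) ≠ (x t₂, y t₂)) ∧
      0 < T ∧
      ∀ t : ℝ, (x (t + T), y (t + T)) = (x t, y t) := by
  rcases lt_or_gt_of_ne ha with h | h
  · obtain ⟨x, y, T, hsol, ⟨t₁, t₂, hne⟩, hT, hper⟩ := ray_pos hn (neg_pos.2 h)
    refine ⟨fun t => -x (-t), fun t => y (-t), T, fun t => ⟨?_, ?_⟩, ⟨-t₁, -t₂, ?_⟩, hT, ?_⟩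
    · have := ((hsol (-t)).1.comp t (hasDerivAt_neg t)).neg
      convert! this using 1
      ring
    · have := (hsol (-t)).2.comp t (hasDerivAt_neg t)
      convert! this using 1
      ring
    · simpa using hne
    · intro t
      have := hper (-(t + T))
      rw [show -(t + T) + T = -t by ring] at this
      simp only [Prod.mk.injEq] at this
      simp only [this.1, this.2]
  · exact ray_pos hn h
end

section
/- For every positive integer n and every real a ≠ 0, the Liénard system L_a has exactly one limit cycle: there exists a periodic orbit Γ of L_a which is a limit cycle, and any two limit cycles of L_a coincide as subsets of ℝ². -/
/-- `(x, y)` is a solution of the Liénard system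
`ẋ = y + a (x^(2n) - 1) x`, `ẏ = -x`. -/
def IsSolLienard (n : ℕ) (a : ℝ) (x y : ℝ → ℝ) : Prop :=
  ∀ t : ℝ, HasDerivAt x (y t + a * ((x t) ^ (2 * n) - 1) * x t) t ∧
    HasDerivAt y (-x t) t

/-- `Γ` is a periodic orbit of the Liénard system: the image in `ℝ²` of a nonconstant
periodic solution. -/
def IsPeriodicOrbitLienard (n : ℕ) (a : ℝ) (Γ : Set (ℝ × ℝ)) : Prop :=
  ∃ x y : ℝ → ℝ, IsSolLienard n a x y ∧
    (∃ t₁ t₂ : ℝ, (x t₁, y t₁) ≠ (x t₂, y t₂)) ∧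
    (∃ T : ℝ, 0 < T ∧ ∀ t : ℝ, (x (t + T), y (t + T)) = (x t, y t)) ∧
    Γ = Set.range (fun t : ℝ => (x t, y t))

/-- `Γ` is a limit cycle of the Liénard system: a periodic orbit having an open
neighborhood `U` in which it is the only periodic orbit. -/
def IsLimitCycleLienard (n : ℕ) (a : ℝ) (Γ : Set (ℝ × ℝ)) : Prop :=
  IsPeriodicOrbitLienard n a Γ ∧
  ∃ U : Set (ℝ × ℝ), IsOpen U ∧ Γ ⊆ U ∧
    ∀ Γ' : Set (ℝ × ℝ), IsPeriodicOrbitLienard n a Γ' → Γ' ⊆ U → Γ' = Γ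

open Set Filter Topology

/-- clamp to `[-R, R]` -/
noncomputable def clampR (R u : ℝ) : ℝ := max (-R) (min R u)

/-- truncated vector field -/
noncomputable def truncV (n : ℕ) (b R : ℝ) (p : ℝ × ℝ) : ℝ × ℝ :=
  (clampR R p.2 - b * ((clampR R p.1) ^ (2 * n + 1) - clampR R p.1), -clampR R p.1)

lemma clampR_of_abs {R u : ℝ} (h : |u| ≤ R) : clampR R u = u := by
  rw [abs_le] at h
  simp [clampR, h.1, h.2]

lemma clampR_abs {R : ℝ} (hR : 0 ≤ R) (u : ℝ) : |clampR R u| ≤ R := by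
  rw [abs_le]
  refine ⟨le_max_left _ _, max_le (by linarith) (min_le_left _ _)⟩

lemma clampR_neg {R : ℝ} (hR : 0 ≤ R) (u : ℝ) : clampR R (-u) = - clampR R u := by
  unfold clampR
  grind

lemma clampR_lip (R : ℝ) : LipschitzWith 1 (clampR R) :=
  (LipschitzWith.id.const_min R).const_max (-R)

lemma truncV_lip (n : ℕ) (b R : ℝ) (hR : 0 ≤ R) : ∃ K, LipschitzWith K (truncV n b R) := by
  have h1 : ContDiff ℝ 1 (fun u : ℝ => b * (u ^ (2 * n + 1) - u)) := by fun_prop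
  obtain ⟨K, hK⟩ := h1.contDiffOn.exists_lipschitzOnWith (s := Icc (-R) R) one_ne_zero
    (convex_Icc _ _) isCompact_Icc
  have h2 : LipschitzWith (K * 1) (fun u : ℝ => b * ((clampR R u) ^ (2 * n + 1) - clampR R u)) := by
    have := hK.comp (clampR_lip R).lipschitzOnWith (s := univ)
      (fun u _ => abs_le.1 (clampR_abs hR u))
    exact lipschitzOnWith_univ.1 this
  have h3 := ((clampR_lip R).comp LipschitzWith.prod_snd).sub (h2.comp LipschitzWith.prod_fst)
  have h4 := ((clampR_lip R).comp (LipschitzWith.prod_fst (α := ℝ) (β := ℝ))).neg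
  exact ⟨_, h3.prodMk h4⟩

lemma truncV_bdd (n : ℕ) (b R : ℝ) (hR : 0 ≤ R) : ∃ L : NNReal, ∀ p, ‖truncV n b R p‖ ≤ L := by
  have hc : Continuous (fun p : ℝ × ℝ => ((p.2 - b * (p.1 ^ (2 * n + 1) - p.1), -p.1) : ℝ × ℝ)) := by
    fun_prop
  obtain ⟨C, hC⟩ := ((isCompact_Icc (a := -R) (b := R)).prod
    (isCompact_Icc (a := -R) (b := R))).exists_bound_of_continuousOn hc.continuousOn
  refine ⟨C.toNNReal, fun p => ?_⟩
  have := hC (clampR R p.1, clampR R p.2)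
    ⟨abs_le.1 (clampR_abs hR _), abs_le.1 (clampR_abs hR _)⟩
  exact this.trans (Real.le_coe_toNNReal C)

lemma truncV_neg (n : ℕ) (b R : ℝ) (hR : 0 ≤ R) (p : ℝ × ℝ) :
    truncV n b R (-p) = - truncV n b R p := by
  have h : Odd (2 * n + 1) := ⟨n, rfl⟩
  simp only [truncV, Prod.fst_neg, Prod.snd_neg, clampR_neg hR, h.neg_pow, Prod.neg_mk]
  congr 1
  ring

lemma global_exists {V : ℝ × ℝ → ℝ × ℝ} {K L : NNReal} (hK : LipschitzWith K V)
    (hL : ∀ p, ‖V p‖ ≤ L) (p : ℝ × ℝ) :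
    ∃ z : ℝ → ℝ × ℝ, z 0 = p ∧ ∀ t, HasDerivAt z (V (z t)) t := by
  have loc : ∀ N : ℕ, ∃ z : ℝ → ℝ × ℝ, z 0 = p ∧
      ∀ t ∈ Ioo (-(N + 1 : ℝ)) (N + 1), HasDerivAt z (V (z t)) t := by
    intro N
    have h0 : (0 : ℝ) ∈ Icc (-(N + 1 : ℝ)) (N + 1) := by
      constructor <;> linarith [(Nat.cast_nonneg N : (0 : ℝ) ≤ N)]
    have hp : IsPicardLindelof (fun _ => V) (⟨0, h0⟩ : Icc (-(N + 1 : ℝ)) (N + 1)) p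
        (L * (N + 1)) 0 L K := by
      constructor
      · exact fun t _ => hK.lipschitzOnWith
      · exact fun x _ => continuousOn_const
      · exact fun t _ x _ => hL x
      · simp
    obtain ⟨z, hz0, hz⟩ := hp.exists_eq_forall_mem_Icc_hasDerivWithinAt₀
    exact ⟨z, hz0, fun t ht => (hz t (Ioo_subset_Icc_self ht)).hasDerivAt (Icc_mem_nhds ht.1 ht.2)⟩
  choose z hz0 hz using loc
  have agree : ∀ N M : ℕ, N ≤ M → ∀ t ∈ Ioo (-(N + 1 : ℝ)) (N + 1), z N t = z M t := by
    intro N M hNM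
    have hc : (N : ℝ) ≤ M := by exact_mod_cast hNM
    have hN : (0 : ℝ) ≤ N := Nat.cast_nonneg N
    refine ODE_solution_unique_of_mem_Ioo (v := fun _ => V) (s := fun _ => univ) (K := K) (t₀ := 0)
      (fun t _ => hK.lipschitzOnWith) ⟨by linarith, by linarith⟩
      (fun t ht => ⟨hz N t ht, trivial⟩)
      (fun t ht => ⟨hz M t ⟨by linarith [ht.1], by linarith [ht.2]⟩, trivial⟩) ?_
    rw [hz0, hz0]
  have agree' : ∀ N M : ℕ, ∀ t : ℝ, |t| < N + 1 → |t| < M + 1 → z N t = z M t := by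
    intro N M t h1 h2
    rcases le_total N M with h | h
    · exact agree N M h t (abs_lt.1 h1)
    · exact (agree M N h t (abs_lt.1 h2)).symm
  refine ⟨fun t => z ⌈|t|⌉₊ t, hz0 _, fun t => ?_⟩
  have ht : |t| < (⌈|t|⌉₊ : ℝ) + 1 := by linarith [Nat.le_ceil |t|]
  have hd := hz ⌈|t|⌉₊ t (abs_lt.1 ht)
  refine hd.congr_of_eventuallyEq ?_
  have : ∀ᶠ s in 𝓝 t, |s| < (⌈|t|⌉₊ : ℝ) + 1 := continuous_abs.continuousAt.eventually_lt_const ht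
  filter_upwards [this] with s hs
  exact agree' _ _ s (by linarith [Nat.le_ceil |s|]) hs

lemma nonpos_of_deriv {W W' : ℝ → ℝ} {C s T : ℝ} (hc : ContinuousOn W (Icc s T))
    (hd : ∀ t ∈ Ioo s T, HasDerivAt W (W' t) t)
    (hle : ∀ t ∈ Ioo s T, 0 < W t → W' t ≤ C * W t) (hs : W s ≤ 0) :
    ∀ t ∈ Icc s T, W t ≤ 0 := by
  intro t ht
  by_contra hpos
  push Not at hpos
  have hcs : ContinuousOn W (Icc s t) := hc.mono (Icc_subset_Icc_right ht.2)
  have hcomp : IsCompact (Icc s t ∩ W ⁻¹' Iic 0) :=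
    isCompact_Icc.of_isClosed_subset (hcs.preimage_isClosed_of_isClosed isClosed_Icc isClosed_Iic)
      inter_subset_left
  obtain ⟨r, ⟨⟨hr1, hr2⟩, hrW⟩, hr⟩ := hcomp.exists_isGreatest ⟨s, ⟨le_refl s, ht.1⟩, hs⟩
  simp only [mem_preimage, mem_Iic] at hrW
  have hrt : r < t := lt_of_le_of_ne hr2 (by rintro rfl; linarith)
  have hWpos : ∀ u ∈ Ioo r t, 0 < W u := by
    intro u hu
    by_contra h
    push Not at h
    have := hr (show u ∈ _ from ⟨⟨by linarith [hu.1], hu.2.le⟩, h⟩)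
    linarith [hu.1]
  have hanti : AntitoneOn (fun u => W u * Real.exp (-C * u)) (Icc r t) := by
    refine antitoneOn_of_hasDerivWithinAt_nonpos (convex_Icc r t)
      (f' := fun u => W' u * Real.exp (-C * u) + W u * (Real.exp (-C * u) * -C)) ?_ ?_ ?_
    · exact (hcs.mono (Icc_subset_Icc_left hr1)).mul (by fun_prop)
    · intro u hu
      rw [interior_Icc] at hu
      have h1 := hd u ⟨by linarith [hu.1], by linarith [hu.2, ht.2]⟩
      have h2 : HasDerivAt (fun u => Real.exp (-C * u)) (Real.exp (-C * u) * -C) u := by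
        have := ((hasDerivAt_id u).const_mul (-C)).exp
        simpa using this
      exact (h1.mul h2).hasDerivWithinAt
    · intro u hu
      rw [interior_Icc] at hu
      have h1 := hle u ⟨by linarith [hu.1], by linarith [hu.2, ht.2]⟩ (hWpos u hu)
      nlinarith [Real.exp_pos (-C * u)]
  have := hanti (left_mem_Icc.2 hrt.le) (right_mem_Icc.2 hrt.le) hrt.le
  simp only at this
  have h3 := mul_pos hpos (Real.exp_pos (-C * t))
  have h4 := mul_nonpos_of_nonpos_of_nonneg hrW (Real.exp_pos (-C * r)).le
  linarith

lemma nonneg_of_deriv {W W' : ℝ → ℝ} {C s T : ℝ} (hc : ContinuousOn W (Icc s T))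
    (hd : ∀ t ∈ Ioo s T, HasDerivAt W (W' t) t)
    (hle : ∀ t ∈ Ioo s T, W t < 0 → W' t ≤ C * (-W t)) (hs : 0 ≤ W T) :
    ∀ t ∈ Icc s T, 0 ≤ W t := by
  intro t ht
  have := nonpos_of_deriv (W := fun u => - W (s + T - u)) (W' := fun u => W' (s + T - u))
    (C := C) (s := s) (T := T) ?_ ?_ ?_ (by simpa using hs) (s + T - t)
    ⟨by linarith [ht.2], by linarith [ht.1]⟩
  · simp at this
    exact this
  · refine (hc.comp (f := fun u => s + T - u) (by fun_prop) ?_).neg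
    intro u hu
    exact ⟨by linarith [hu.2], by linarith [hu.1]⟩
  · intro u hu
    have h1 := hd (s + T - u) ⟨by linarith [hu.2], by linarith [hu.1]⟩
    have h2 := (HasDerivAt.comp_const_sub (s + T) u h1).neg
    rw [neg_neg] at h2
    exact h2
  · intro u hu hpos
    exact hle (s + T - u) ⟨by linarith [hu.2], by linarith [hu.1]⟩ (by linarith)

lemma exists_inverse {y : ℝ → ℝ} {T : ℝ} (hT : 0 < T) (hc : ContinuousOn y (Icc 0 T))
    (ha : StrictAntiOn y (Icc 0 T)) :
    ∃ τ : ℝ → ℝ, Continuous τ ∧ ∀ t ∈ Icc 0 T, τ (y t) = t := by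
  let pr : ℝ → ℝ := fun t => max 0 (min T t)
  have hpr : ∀ t, pr t ∈ Icc 0 T := fun t => ⟨le_max_left _ _, max_le hT.le (min_le_left _ _)⟩
  have hprc : Continuous pr := by fun_prop
  let Y : ℝ → ℝ := fun t => t - pr t - y (pr t)
  have hYc : Continuous Y := by
    have : Continuous (fun t => y (pr t)) := hc.comp_continuous hprc hpr
    exact (continuous_id.sub hprc).sub this
  have hYm : StrictMono Y := by
    intro s t hst
    have h1 : s - pr s ≤ t - pr t := by simp only [pr]; grind
    have h2 : pr s ≤ pr t := by simp only [pr]; grind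
    rcases h2.eq_or_lt with h | h
    · simp only [Y, h]; linarith
    · have := ha (hpr s) (hpr t) h
      simp only [Y]; linarith
  have hY1 : ∀ t, T ≤ t → Y t = t - T - y T := by
    intro t h
    have : pr t = T := by simp only [pr]; grind
    simp only [Y, this]
  have hY0 : ∀ t, t ≤ 0 → Y t = t - y 0 := by
    intro t h
    have : pr t = 0 := by simp only [pr]; grind
    simp only [Y, this]; ring
  have hs : Function.Surjective Y := by
    refine hYc.surjective ?_ ?_
    · refine tendsto_atTop_mono' _ ((eventually_ge_atTop T).mono fun t ht => (hY1 t ht).ge) ?_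
      simpa [sub_eq_add_neg, add_assoc] using
        tendsto_atTop_add_const_right atTop (-T - y T) tendsto_id
    · refine tendsto_atBot_mono' _ ((eventually_le_atBot 0).mono fun t ht => (hY0 t ht).le) ?_
      simpa [sub_eq_add_neg, add_assoc] using
        tendsto_atBot_add_const_right atBot (- y 0) tendsto_id
  let e := hYm.orderIsoOfSurjective Y hs
  refine ⟨fun v => e.symm (-v), e.symm.continuous.comp continuous_neg, fun t ht => ?_⟩
  have hp : pr t = t := by
    have := ht.1
    have := ht.2
    simp only [pr]; grind
  have : e t = - y t := by
    change Y t = _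
    simp only [Y, hp]; ring
  change e.symm (-y t) = t
  rw [← this]
  exact e.symm_apply_apply t

/-- A right half-plane arc. -/
def IsArc (n : ℕ) (b c α β T : ℝ) (x y : ℝ → ℝ) : Prop :=
  0 < T ∧ (∀ t ∈ Icc 0 T, HasDerivAt x (y t - b * (c * (x t) ^ (2 * n + 1) - x t)) t ∧
    HasDerivAt y (-x t) t) ∧ x 0 = 0 ∧ y 0 = α ∧ x T = 0 ∧ y T = -β ∧ ∀ t ∈ Ioo 0 T, 0 < x t

lemma IsArc.anti {n : ℕ} {b c α β T : ℝ} {x y : ℝ → ℝ} (h : IsArc n b c α β T x y) :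
    StrictAntiOn y (Icc 0 T) := by
  obtain ⟨hT, hd, -, -, -, -, hpos⟩ := h
  refine strictAntiOn_of_hasDerivWithinAt_neg (convex_Icc 0 T) (f' := fun t => - x t)
    (fun t ht => (hd t ht).2.continuousAt.continuousWithinAt) ?_ ?_
  · intro t ht
    rw [interior_Icc] at ht
    exact (hd t (Ioo_subset_Icc_self ht)).2.hasDerivWithinAt
  · intro t ht
    rw [interior_Icc] at ht
    linarith [hpos t ht]

lemma IsArc.contx {n : ℕ} {b c α β T : ℝ} {x y : ℝ → ℝ} (h : IsArc n b c α β T x y) :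
    ContinuousOn x (Icc 0 T) := fun t ht => (h.2.1 t ht).1.continuousAt.continuousWithinAt

lemma IsArc.conty {n : ℕ} {b c α β T : ℝ} {x y : ℝ → ℝ} (h : IsArc n b c α β T x y) :
    ContinuousOn y (Icc 0 T) := fun t ht => (h.2.1 t ht).2.continuousAt.continuousWithinAt

lemma IsArc.surj {n : ℕ} {b c α β T : ℝ} {x y : ℝ → ℝ} (h : IsArc n b c α β T x y)
    {v : ℝ} (hv : v ∈ Icc (-β) α) : ∃ t ∈ Icc 0 T, y t = v := by
  have := intermediate_value_Icc' h.1.le h.conty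
  rw [h.2.2.2.1, h.2.2.2.2.2.1] at this
  exact this hv

lemma IsArc.graph {n : ℕ} {b c α β T : ℝ} {x y : ℝ → ℝ} (h : IsArc n b c α β T x y) :
    ∃ g : ℝ → ℝ, ContinuousOn g (Icc (-β) α) ∧ g (-β) = 0 ∧ g α = 0 ∧
      ∀ v ∈ Ioo (-β) α, 0 < g v ∧
        HasDerivAt (fun v => g v ^ 2) (2 * (b * (c * (g v) ^ (2 * n + 1) - g v) - v)) v := by
  obtain ⟨τ, hτc, hτ⟩ := exists_inverse h.1 h.conty h.anti
  have hsurj := @IsArc.surj _ _ _ _ _ _ _ _ h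
  have hcx := h.contx
  obtain ⟨hT, hd, hx0, hy0, hxT, hyT, hpos⟩ := h
  refine ⟨fun v => x (τ v), ?_, ?_, ?_, ?_⟩
  · refine hcx.comp hτc.continuousOn ?_
    intro v hv
    obtain ⟨t, ht, rfl⟩ := hsurj hv
    rw [hτ t ht]; exact ht
  · simp only
    rw [← hyT, hτ T ⟨hT.le, le_refl _⟩, hxT]
  · simp only
    rw [← hy0, hτ 0 ⟨le_refl _, hT.le⟩, hx0]
  · intro v hv
    obtain ⟨t, ht, htv⟩ := hsurj (Ioo_subset_Icc_self hv)
    have hτv : τ v = t := by rw [← htv, hτ t ht]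
    have ht' : t ∈ Ioo 0 T := by
      refine ⟨lt_of_le_of_ne ht.1 ?_, lt_of_le_of_ne ht.2 ?_⟩
      · rintro rfl
        linarith [hv.2]
      · rintro rfl
        linarith [hv.1]
    have hxp := hpos t ht'
    have hdτ : HasDerivAt τ (-x t)⁻¹ v := by
      refine HasDerivAt.of_local_left_inverse (f := y) hτc.continuousAt ?_ (by linarith) ?_
      · rw [hτv]; exact (hd t ht).2
      · filter_upwards [Ioo_mem_nhds hv.1 hv.2] with w hw
        obtain ⟨s, hs, rfl⟩ := hsurj (Ioo_subset_Icc_self hw)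
        rw [hτ s hs]
    have hdx : HasDerivAt x (v - b * (c * (x t) ^ (2 * n + 1) - x t)) (τ v) := by
      rw [hτv, ← htv]; exact (hd t ht).1
    have hcomp := (hdx.comp v hdτ).pow 2
    refine ⟨by simp only [hτv]; exact hxp, ?_⟩
    refine hcomp.congr_deriv ?_
    simp only [Function.comp, hτv]
    field_simp
    push_cast
    ring

lemma pow_sub_le {h X : ℝ} (m : ℕ) (h0 : 0 ≤ h) (hX : h ≤ X) :
    X ^ (m + 1) - h ^ (m + 1) ≤ (m + 1) * X ^ m * (X - h) := by
  induction m with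
  | zero => simp
  | succ k ih =>
    have hX0 : 0 ≤ X := h0.trans hX
    have h1 : h ^ (k + 1) ≤ X ^ (k + 1) := pow_le_pow_left₀ h0 hX _
    have e : X ^ (k + 1 + 1) - h ^ (k + 1 + 1) =
      X * (X ^ (k + 1) - h ^ (k + 1)) + h ^ (k + 1) * (X - h) := by ring
    have h2 := mul_le_mul_of_nonneg_left ih hX0
    have h3 := mul_le_mul_of_nonneg_right h1 (sub_nonneg.2 hX)
    rw [e]
    push_cast
    calc _ ≤ X * ((k + 1) * X ^ k * (X - h)) + X ^ (k + 1) * (X - h) := add_le_add h2 h3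
      _ = _ := by ring

/-- Comparison of arcs. -/
lemma arc_compare {n : ℕ} {b c₁ c₂ α₁ α₂ β₁ β₂ T₁ T₂ : ℝ} {x₁ y₁ x₂ y₂ : ℝ → ℝ}
    (h₁ : IsArc n b c₁ α₁ β₁ T₁ x₁ y₁) (h₂ : IsArc n b c₂ α₂ β₂ T₂ x₂ y₂)
    (hb : 0 < b) (hc₁ : 0 ≤ c₁) (hc : c₁ ≤ c₂) (hα₂ : 0 < α₂) (hβ₁ : 0 < β₁)
    (hα : α₂ ≤ α₁) (hβ : β₁ ≤ β₂) : c₁ = c₂ ∧ α₁ = α₂ ∧ β₁ = β₂ := by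
  obtain ⟨g, hgc, hgβ, hgα, hg⟩ := h₂.graph
  obtain ⟨s, hs, hys⟩ := h₁.surj (v := α₂) ⟨by linarith, hα⟩
  have hanti := h₁.anti
  have hcx := h₁.contx
  have hcy := h₁.conty
  obtain ⟨hT, hd, hx0, hy0, hxT, hyT, hpos⟩ := h₁
  have hsT : s < T₁ := by
    refine lt_of_le_of_ne hs.2 ?_
    rintro rfl
    linarith
  have hsub : Icc s T₁ ⊆ Icc 0 T₁ := Icc_subset_Icc_left hs.1
  have hxnn : ∀ t ∈ Icc 0 T₁, 0 ≤ x₁ t := by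
    intro t ht
    rcases ht.1.eq_or_lt with h | h
    · rw [← h, hx0]
    rcases ht.2.eq_or_lt with h' | h'
    · rw [h', hxT]
    exact (hpos t ⟨h, h'⟩).le
  have hymem : ∀ t ∈ Icc s T₁, y₁ t ∈ Icc (-β₁) α₂ := by
    intro t ht
    have a1 := hanti.antitoneOn hs (hsub ht) ht.1
    have a2 := hanti.antitoneOn (hsub ht) ⟨hT.le, le_refl _⟩ ht.2
    exact ⟨by linarith, by linarith⟩
  have hymem' : ∀ t ∈ Ioo s T₁, y₁ t ∈ Ioo (-β₂) α₂ := by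
    intro t ht
    have a1 := hanti hs (hsub (Ioo_subset_Icc_self ht)) ht.1
    have a2 := hanti (hsub (Ioo_subset_Icc_self ht)) ⟨hT.le, le_refl _⟩ ht.2
    exact ⟨by linarith, by linarith⟩
  have hsub2 : Icc (-β₁) α₂ ⊆ Icc (-β₂) α₂ := Icc_subset_Icc_left (by linarith)
  set W : ℝ → ℝ := fun t => g (y₁ t) ^ 2 - x₁ t ^ 2 with hW
  set W' : ℝ → ℝ := fun t => -2 * x₁ t * (b * (c₂ * (g (y₁ t)) ^ (2 * n + 1) - g (y₁ t))
    - b * (c₁ * (x₁ t) ^ (2 * n + 1) - x₁ t)) with hW'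
  have hWc : ContinuousOn W (Icc s T₁) := by
    refine ContinuousOn.sub (ContinuousOn.pow ?_ 2) ((hcx.mono hsub).pow 2)
    exact hgc.comp (hcy.mono hsub) (fun t ht => hsub2 (hymem t ht))
  have hWd : ∀ t ∈ Ioo s T₁, HasDerivAt W (W' t) t := by
    intro t ht
    have htI := hsub (Ioo_subset_Icc_self ht)
    have d1 := HasDerivAt.comp t (hg (y₁ t) (hymem' t ht)).2 (hd t htI).2
    have d2 := (hd t htI).1.pow 2
    refine (d1.sub d2).congr_deriv ?_
    simp only [hW']
    push_cast
    ring
  obtain ⟨B, hB⟩ := isCompact_Icc.exists_bound_of_continuousOn hcx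
  have hWs : W s ≤ 0 := by
    simp only [hW, hys, hgα]
    nlinarith [sq_nonneg (x₁ s)]
  have hWT : 0 ≤ W T₁ := by
    simp only [hW, hxT]
    nlinarith [sq_nonneg (g (y₁ T₁))]
  have hle : ∀ t ∈ Icc s T₁, W t ≤ 0 := by
    refine nonpos_of_deriv (C := b) hWc hWd ?_ hWs
    intro t ht hWt
    have hX := hxnn t (hsub (Ioo_subset_Icc_self ht))
    have hgp := (hg (y₁ t) (hymem' t ht)).1
    simp only [hW] at hWt
    simp only [hW', hW]
    set X := x₁ t
    set h := g (y₁ t)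
    have hXh : X ≤ h := by nlinarith
    have p1 : X ^ (2 * n + 1) ≤ h ^ (2 * n + 1) := pow_le_pow_left₀ hX hXh _
    have p0 : 0 ≤ X ^ (2 * n + 1) := pow_nonneg hX _
    have p2 : c₁ * X ^ (2 * n + 1) ≤ c₂ * h ^ (2 * n + 1) :=
      mul_le_mul hc p1 p0 (hc₁.trans hc)
    have p3 : 0 ≤ X * b := by positivity
    have p4 := mul_le_mul_of_nonneg_left p2 p3
    nlinarith [mul_nonneg hb.le (sq_nonneg (h - X))]
  have hge : ∀ t ∈ Icc s T₁, 0 ≤ W t := by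
    refine nonneg_of_deriv (C := 2 * b * c₂ * ((2 * n : ℕ) + 1) * B ^ (2 * n)) hWc hWd ?_ hWT
    intro t ht hWt
    have hX := hxnn t (hsub (Ioo_subset_Icc_self ht))
    have hXB : x₁ t ≤ B := (le_abs_self _).trans (hB t (hsub (Ioo_subset_Icc_self ht)))
    have hgp := (hg (y₁ t) (hymem' t ht)).1
    simp only [hW] at hWt
    simp only [hW', hW]
    set X := x₁ t
    set h := g (y₁ t)
    have hXh : h ≤ X := by nlinarith
    have p1 := pow_sub_le (2 * n) hgp.le hXh
    have p0 : 0 ≤ X ^ (2 * n + 1) := pow_nonneg hX _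
    have p2 : X ^ (2 * n) ≤ B ^ (2 * n) := pow_le_pow_left₀ hX hXB _
    have hB0 : 0 ≤ B := hX.trans hXB
    have hc2 : 0 ≤ c₂ := hc₁.trans hc
    have p3 : c₂ * (X ^ (2 * n + 1) - h ^ (2 * n + 1)) ≤
        c₂ * (((2 * n : ℕ) + 1) * B ^ (2 * n) * (X - h)) := by
      refine mul_le_mul_of_nonneg_left (p1.trans ?_) hc2
      have : 0 ≤ X - h := by linarith
      gcongr
    have p4 : c₁ * X ^ (2 * n + 1) ≤ c₂ * X ^ (2 * n + 1) := by gcongr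
    set M := ((2 * n : ℕ) + 1 : ℝ) * B ^ (2 * n) with hM
    have hMn : 0 ≤ M := by positivity
    have p5 : 0 ≤ 2 * X * b := by positivity
    have p6 : b * (c₁ * X ^ (2 * n + 1) - X) - b * (c₂ * h ^ (2 * n + 1) - h)
        ≤ b * (c₂ * (M * (X - h))) := by
      rw [← mul_sub]
      refine mul_le_mul_of_nonneg_left ?_ hb.le
      linarith
    have p7 : 2 * X * (b * (c₂ * (M * (X - h)))) ≤ 2 * (X + h) * (b * (c₂ * (M * (X - h)))) := by
      have : 0 ≤ b * (c₂ * (M * (X - h))) := by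
        have : 0 ≤ X - h := by linarith
        positivity
      nlinarith
    have p8 := mul_le_mul_of_nonneg_left p6 (show 0 ≤ 2 * X by positivity)
    calc _ = 2 * X * (b * (c₁ * X ^ (2 * n + 1) - X) - b * (c₂ * h ^ (2 * n + 1) - h)) := by ring
      _ ≤ 2 * (X + h) * (b * (c₂ * (M * (X - h)))) := p8.trans p7
      _ = _ := by rw [hM]; ring
  have hz : ∀ t ∈ Icc s T₁, W t = 0 := fun t ht => le_antisymm (hle t ht) (hge t ht)
  have hβe : β₁ = β₂ := by
    by_contra hne
    have hlt : β₁ < β₂ := lt_of_le_of_ne hβ hne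
    have := hz T₁ ⟨hsT.le, le_refl _⟩
    simp only [hW, hxT, hyT] at this
    have hp := (hg (-β₁) ⟨by linarith, by linarith⟩).1
    nlinarith
  have hαe : α₁ = α₂ := by
    have := hz s ⟨le_refl _, hsT.le⟩
    simp only [hW, hys, hgα] at this
    rcases hs.1.eq_or_lt with h | h
    · rw [← hy0, ← hys, h]
    · have := hpos s ⟨h, hsT⟩
      nlinarith
  refine ⟨?_, hαe, hβe⟩
  have hmid : (s + T₁) / 2 ∈ Ioo s T₁ := ⟨by linarith, by linarith⟩
  set t := (s + T₁) / 2
  have hloc : W =ᶠ[𝓝 t] fun _ => 0 := by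
    filter_upwards [Ioo_mem_nhds hmid.1 hmid.2] with u hu
    exact hz u (Ioo_subset_Icc_self hu)
  have hder : W' t = 0 :=
    (hWd t hmid).unique ((hasDerivAt_const t (0 : ℝ)).congr_of_eventuallyEq hloc)
  have hXp := hpos t ⟨by linarith [hs.1, hmid.1], hmid.2⟩
  have hgp := (hg (y₁ t) (hymem' t hmid)).1
  have hWt := hz t (Ioo_subset_Icc_self hmid)
  simp only [hW] at hWt
  have hXh : g (y₁ t) = x₁ t := by
    rcases sq_eq_sq_iff_eq_or_eq_neg.1 (sub_eq_zero.1 hWt) with h | h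
    · exact h
    · linarith
  simp only [hW', hXh] at hder
  have hXm : 0 < x₁ t ^ (2 * n + 1) := pow_pos hXp _
  have : x₁ t * b * (x₁ t ^ (2 * n + 1)) * (c₂ - c₁) = 0 := by linear_combination (-1 / 2) * hder
  have hne : x₁ t * b * (x₁ t ^ (2 * n + 1)) ≠ 0 := by positivity
  have := (mul_eq_zero.1 this).resolve_left hne
  linarith

/-- Global solutions of the truncated system. -/
def TSol (n : ℕ) (b R : ℝ) (x y : ℝ → ℝ) : Prop :=
  ∀ t, HasDerivAt x (clampR R (y t) - b * ((clampR R (x t)) ^ (2 * n + 1) - clampR R (x t))) t ∧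
    HasDerivAt y (-clampR R (x t)) t

lemma TSol.exists (n : ℕ) (b : ℝ) {R : ℝ} (hR : 0 ≤ R) (p q : ℝ) :
    ∃ x y, TSol n b R x y ∧ x 0 = p ∧ y 0 = q := by
  obtain ⟨K, hK⟩ := truncV_lip n b R hR
  obtain ⟨L, hL⟩ := truncV_bdd n b R hR
  obtain ⟨z, hz0, hz⟩ := global_exists hK hL (p, q)
  refine ⟨fun t => (z t).1, fun t => (z t).2, fun t => ⟨?_, ?_⟩, by simp [hz0], by simp [hz0]⟩
  · exact (hasFDerivAt_fst (𝕜 := ℝ) (p := z t)).comp_hasDerivAt t (hz t)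
  · exact (hasFDerivAt_snd (𝕜 := ℝ) (p := z t)).comp_hasDerivAt t (hz t)

lemma TSol.unique {n : ℕ} {b R : ℝ} (hR : 0 ≤ R) {x y x' y' : ℝ → ℝ} (h : TSol n b R x y)
    (h' : TSol n b R x' y') {t₀ : ℝ} (hx : x t₀ = x' t₀) (hy : y t₀ = y' t₀) :
    x = x' ∧ y = y' := by
  obtain ⟨K, hK⟩ := truncV_lip n b R hR
  have := ODE_solution_unique_univ (v := fun _ => truncV n b R) (s := fun _ => univ) (K := K)
    (t₀ := t₀) (f := fun t => (x t, y t)) (g := fun t => (x' t, y' t))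
    (fun t => hK.lipschitzOnWith) (fun t => ⟨(h t).1.prodMk (h t).2, trivial⟩)
    (fun t => ⟨(h' t).1.prodMk (h' t).2, trivial⟩) (by simp [hx, hy])
  constructor
  · funext t
    exact congrArg Prod.fst (congrFun this t)
  · funext t
    exact congrArg Prod.snd (congrFun this t)

lemma TSol.neg {n : ℕ} {b R : ℝ} (hR : 0 ≤ R) {x y : ℝ → ℝ} (h : TSol n b R x y) :
    TSol n b R (fun t => - x t) (fun t => - y t) := by
  have ho : Odd (2 * n + 1) := ⟨n, rfl⟩
  intro t
  refine ⟨(h t).1.neg.congr_deriv ?_, (h t).2.neg.congr_deriv ?_⟩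
  · simp only [clampR_neg hR, ho.neg_pow]
    ring
  · simp only [clampR_neg hR]

lemma TSol.shift {n : ℕ} {b R : ℝ} {x y : ℝ → ℝ} (h : TSol n b R x y) (s : ℝ) :
    TSol n b R (fun t => x (t + s)) (fun t => y (t + s)) := by
  intro t
  exact ⟨(h (t + s)).1.comp_add_const t s, (h (t + s)).2.comp_add_const t s⟩

lemma pos_right {x : ℝ → ℝ} {t₀ d : ℝ} (h : HasDerivAt x d t₀) (h0 : x t₀ = 0) (hd : 0 < d) :
    ∃ ε > 0, ∀ t ∈ Ioo t₀ (t₀ + ε), 0 < x t := by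
  have h1 := (hasDerivAt_iff_tendsto_slope.1 h).eventually (lt_mem_nhds hd)
  rw [eventually_nhdsWithin_iff, Metric.eventually_nhds_iff] at h1
  obtain ⟨ε, hε, h2⟩ := h1
  refine ⟨ε, hε, fun t ht => ?_⟩
  have h3 := h2 (y := t) (by rw [Real.dist_eq, abs_lt]; constructor <;> linarith [ht.1, ht.2])
    (by simpa using ht.1.ne')
  rw [slope_def_field, h0, sub_zero] at h3
  have h4 : 0 < t - t₀ := by linarith [ht.1]
  exact (div_pos_iff_of_pos_right h4).1 h3

lemma neg_left {x : ℝ → ℝ} {t₀ d : ℝ} (h : HasDerivAt x d t₀) (h0 : x t₀ = 0) (hd : 0 < d) :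
    ∃ ε > 0, ∀ t ∈ Ioo (t₀ - ε) t₀, x t < 0 := by
  have h1 : HasDerivAt (fun t => - x (-t)) d (-t₀) := by
    have h' : HasDerivAt x d (-(-t₀)) := by rwa [neg_neg]
    have := (h'.comp (-t₀) (hasDerivAt_neg (-t₀))).neg
    refine this.congr_deriv (by ring)
  obtain ⟨ε, hε, h2⟩ := pos_right h1 (by simp [h0]) hd
  refine ⟨ε, hε, fun t ht => ?_⟩
  have := h2 (-t) ⟨by linarith [ht.2], by linarith [ht.1]⟩
  simpa using this

lemma first_zero {x : ℝ → ℝ} {t₀ d t₂ : ℝ} (hc : Continuous x) (h : HasDerivAt x d t₀)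
    (h0 : x t₀ = 0) (hd : 0 < d) (ht₂ : t₀ < t₂) (hx₂ : x t₂ ≤ 0) :
    ∃ t₁, t₀ < t₁ ∧ t₁ ≤ t₂ ∧ x t₁ = 0 ∧ ∀ t ∈ Ioo t₀ t₁, 0 < x t := by
  obtain ⟨ε, hε, hpos⟩ := pos_right h h0 hd
  have hle : t₀ + ε ≤ t₂ := by
    by_contra hlt
    push Not at hlt
    linarith [hpos t₂ ⟨ht₂, hlt⟩]
  have hcomp : IsCompact (Icc (t₀ + ε / 2) t₂ ∩ x ⁻¹' Iic 0) :=
    isCompact_Icc.inter_right (isClosed_Iic.preimage hc)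
  obtain ⟨r, ⟨⟨hr1, hr2⟩, hrx⟩, hr⟩ := hcomp.exists_isLeast
    ⟨t₂, ⟨by linarith, le_refl _⟩, hx₂⟩
  simp only [mem_preimage, mem_Iic] at hrx
  have hp : ∀ t ∈ Ioo t₀ r, 0 < x t := by
    intro t ht
    rcases lt_or_ge t (t₀ + ε / 2) with h1 | h1
    · exact hpos t ⟨ht.1, by linarith⟩
    · by_contra hneg
      push Not at hneg
      have := hr (show t ∈ _ from ⟨⟨h1, by linarith [ht.2]⟩, hneg⟩)
      linarith [ht.2]
  refine ⟨r, by linarith, hr2, ?_, hp⟩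
  by_contra hne
  have hlt : x r < 0 := lt_of_le_of_ne hrx hne
  have hmid : 0 < x (t₀ + ε / 2) := hpos _ ⟨by linarith, by linarith⟩
  obtain ⟨u, hu, hxu⟩ := intermediate_value_Icc' hr1 hc.continuousOn ⟨hlt.le, hmid.le⟩
  have hur : u < r := lt_of_le_of_ne hu.2 (by rintro rfl; linarith)
  linarith [hp u ⟨by linarith [hu.1], hur⟩]

lemma le_of_deriv_le {f f' : ℝ → ℝ} {s T c : ℝ} (hsT : s ≤ T)
    (hd : ∀ t ∈ Icc s T, HasDerivAt f (f' t) t) (hle : ∀ t ∈ Icc s T, f' t ≤ c) :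
    f T ≤ f s + c * (T - s) := by
  have := nonpos_of_deriv (W := fun t => f t - f s - c * (t - s)) (W' := fun t => f' t - c)
    (C := 0) (s := s) (T := T) ?_ ?_ ?_ (by simp) T ⟨hsT, le_refl _⟩
  · linarith
  · have : ContinuousOn f (Icc s T) := fun t ht => (hd t ht).continuousAt.continuousWithinAt
    fun_prop
  · intro t ht
    have h1 := (hd t (Ioo_subset_Icc_self ht)).sub_const (f s)
    have h2 : HasDerivAt (fun t => c * (t - s)) c t := by
      simpa using ((hasDerivAt_id t).sub_const s).const_mul c
    exact h1.sub h2
  · intro t ht _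
    linarith [hle t (Ioo_subset_Icc_self ht)]

lemma odd_pow_le {n : ℕ} {u : ℝ} (h0 : 0 ≤ u) (h1 : u ≤ 1) : u ^ (2 * n + 1) ≤ u := by
  have := pow_le_one₀ h0 h1 (n := 2 * n)
  rw [pow_succ]
  nlinarith

lemma odd_pow_sub_ge {n : ℕ} {u : ℝ} (h0 : 0 ≤ u) : -1 ≤ u ^ (2 * n + 1) - u := by
  rcases le_total u 1 with h | h
  · have := pow_nonneg h0 (2 * n + 1)
    linarith
  · have := one_le_pow₀ h (n := 2 * n)
    rw [pow_succ]
    nlinarith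

lemma clampR_nonneg {R u : ℝ} (hR : 0 ≤ R) (hu : 0 ≤ u) : 0 ≤ clampR R u :=
  le_max_of_le_right (le_min hR hu)

/-- A priori bound. -/
lemma box {n : ℕ} (hn : 0 < n) {b D A : ℝ} (hb : 0 < b) (hD : D = 1 + 4 / b + b) (hA : A = 4 * D)
    {x y : ℝ → ℝ} (h : TSol n b A x y) (hx0 : x 0 = 0) (hy0 : 0 ≤ y 0) (hyA : y 0 ≤ A) {s : ℝ}
    (hx : ∀ t ∈ Icc 0 s, 0 ≤ x t) :
    ∀ t ∈ Icc 0 s, x t ≤ D ∧ -A ≤ y t ∧ y t ≤ A := by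
  have hb4 : 0 < 4 / b := by positivity
  have hD1 : 1 < D := by linarith
  have hA0 : 0 ≤ A := by linarith
  have hxc : Continuous x := continuous_iff_continuousAt.2 fun t => (h t).1.continuousAt
  have hyc : Continuous y := continuous_iff_continuousAt.2 fun t => (h t).2.continuousAt
  have hxD : ∀ t ∈ Icc 0 s, x t - D ≤ 0 := by
    refine nonpos_of_deriv (C := 0) (W' := fun t => clampR A (y t)
      - b * ((clampR A (x t)) ^ (2 * n + 1) - clampR A (x t))) (by fun_prop)
      (fun t ht => (h t).1.sub_const D) ?_ (by linarith)
    intro t ht hpos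
    set u := clampR A (x t) with hu
    have huD : D ≤ u := le_max_of_le_right (le_min (by linarith) (by linarith))
    have hyle : clampR A (y t) ≤ A := (abs_le.1 (clampR_abs hA0 _)).2
    have h1 : u ≤ u ^ (2 * n) := by
      calc u = u ^ 1 := (pow_one u).symm
        _ ≤ u ^ (2 * n) := pow_le_pow_right₀ (by linarith) (by omega)
    have h2 : 4 / b ≤ u ^ (2 * n) - 1 := by linarith
    have h3 : 4 ≤ b * (u ^ (2 * n) - 1) := by
      have := mul_le_mul_of_nonneg_left h2 hb.le
      rwa [mul_div_cancel₀ _ hb.ne'] at this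
    have h4 : b * (u ^ (2 * n + 1) - u) = (b * (u ^ (2 * n) - 1)) * u := by ring
    rw [h4]
    nlinarith
  have hyle : ∀ t ∈ Icc 0 s, y t - A ≤ 0 := by
    refine nonpos_of_deriv (C := 0) (W' := fun t => -clampR A (x t)) (by fun_prop)
      (fun t ht => (h t).2.sub_const A) ?_ (by linarith)
    intro t ht _
    linarith [clampR_nonneg hA0 (hx t (Ioo_subset_Icc_self ht))]
  have hW : ∀ t ∈ Icc 0 s, x t ^ 2 - A / 2 * y t - (D ^ 2 + A ^ 2 / 4) ≤ 0 := by
    refine nonpos_of_deriv (C := 0) (W' := fun t => 2 * x t * (clampR A (y t)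
      - b * ((clampR A (x t)) ^ (2 * n + 1) - clampR A (x t))) - A / 2 * (-clampR A (x t)))
      (by fun_prop) ?_ ?_ ?_
    · intro t ht
      have h1 := (h t).1.pow 2
      have h2 := (h t).2.const_mul (A / 2)
      refine ((h1.sub h2).sub_const _).congr_deriv ?_
      push_cast
      ring
    · intro t ht hpos
      have hx1 := hx t (Ioo_subset_Icc_self ht)
      have hx2 := hxD t (Ioo_subset_Icc_self ht)
      rw [clampR_of_abs (show |x t| ≤ A by rw [abs_of_nonneg hx1]; linarith)]
      have hyt : y t < - A / 2 := by
        by_contra hcon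
        push Not at hcon
        have : x t ^ 2 ≤ D ^ 2 := pow_le_pow_left₀ hx1 (by linarith) 2
        nlinarith
      have hcy : clampR A (y t) ≤ -A / 2 := max_le (by linarith) ((min_le_right _ _).trans hyt.le)
      have := mul_le_mul_of_nonneg_left (odd_pow_sub_ge (n := n) hx1) hb.le
      have h5 : 2 * (clampR A (y t) - b * (x t ^ (2 * n + 1) - x t)) + A / 2 ≤ 0 := by linarith
      nlinarith
    · rw [hx0]
      have : 0 ≤ A / 2 * y 0 := by positivity
      nlinarith [sq_nonneg D, sq_nonneg A]
  intro t ht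
  refine ⟨by linarith [hxD t ht], ?_, by linarith [hyle t ht]⟩
  have h1 := hW t ht
  by_contra hcon
  push Not at hcon
  have : D ^ 2 = A ^ 2 / 16 := by rw [hA]; ring
  nlinarith [sq_nonneg (x t)]

lemma exists_arc {n : ℕ} (hn : 0 < n) {b D A : ℝ} (hb : 0 < b) (hD : D = 1 + 4 / b + b)
    (hA : A = 4 * D) {α : ℝ} (hα : α ∈ Icc 1 A) :
    ∃ β ∈ Icc 1 A, ∃ T x y, IsArc n b 1 α β T x y ∧ TSol n b A x y ∧
      ∀ t ∈ Icc 0 T, |x t| ≤ A ∧ |y t| ≤ A := by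
  have hb4 : 0 < 4 / b := by positivity
  have hD1 : 1 < D := by linarith
  have hA0 : 0 ≤ A := by linarith
  obtain ⟨x, y, h, hx0, hy0⟩ := TSol.exists n b hA0 0 α
  have hxc : Continuous x := continuous_iff_continuousAt.2 fun t => (h t).1.continuousAt
  have hyc : Continuous y := continuous_iff_continuousAt.2 fun t => (h t).2.continuousAt
  have hbox : ∀ s, (∀ t ∈ Icc 0 s, 0 ≤ x t) → ∀ t ∈ Icc 0 s, x t ≤ D ∧ -A ≤ y t ∧ y t ≤ A := by
    intro s hs
    exact box hn hb hD hA h hx0 (by linarith [hα.1]) (by linarith [hα.2]) hs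
  have hbox' : ∀ s, (∀ t ∈ Icc 0 s, 0 ≤ x t) → ∀ t ∈ Icc 0 s, |x t| ≤ A ∧ |y t| ≤ A := by
    intro s hs t ht
    have := hbox s hs t ht
    exact ⟨by rw [abs_of_nonneg (hs t ht)]; linarith, abs_le.2 this.2⟩
  have htrue : ∀ s, (∀ t ∈ Icc 0 s, 0 ≤ x t) → ∀ t ∈ Icc 0 s,
      HasDerivAt x (y t - b * (1 * (x t) ^ (2 * n + 1) - x t)) t ∧ HasDerivAt y (-x t) t := by
    intro s hs t ht
    have h1 := hbox' s hs t ht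
    have h2 := h t
    rw [clampR_of_abs h1.1, clampR_of_abs h1.2] at h2
    rwa [one_mul]
  have hd0 : HasDerivAt x α 0 := by
    have := (htrue 0 (by intro t ht; rw [le_antisymm ht.2 ht.1, hx0]) 0 (by simp)).1
    rw [hx0, hy0] at this
    simpa using this
  have hα0 : 0 < α := by linarith [hα.1]
  by_cases hex : ∃ t₂ > 0, x t₂ ≤ 0
  · obtain ⟨t₂, ht₂, hxt₂⟩ := hex
    obtain ⟨T, hT, -, hxT, hpos⟩ := first_zero hxc hd0 hx0 hα0 ht₂ hxt₂
    have hnn : ∀ t ∈ Icc 0 T, 0 ≤ x t := by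
      intro t ht
      rcases ht.1.eq_or_lt with h | h
      · rw [← h, hx0]
      rcases ht.2.eq_or_lt with h' | h'
      · rw [h', hxT]
      exact (hpos t ⟨h, h'⟩).le
    have hT' : T ∈ Icc 0 T := ⟨hT.le, le_refl _⟩
    have hyT0 : y T ≤ 0 := by
      by_contra hcon
      push Not at hcon
      have hd := (htrue T hnn T hT').1
      rw [hxT] at hd
      obtain ⟨ε, hε, hneg⟩ := neg_left hd hxT (by simpa using hcon)
      have hm : max (T / 2) (T - ε / 2) < T := max_lt (by linarith) (by linarith)
      have := hneg (max (T / 2) (T - ε / 2)) ⟨lt_max_of_lt_right (by linarith), hm⟩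
      have := hpos (max (T / 2) (T - ε / 2)) ⟨lt_max_of_lt_left (by linarith), hm⟩
      linarith
    have hdisk : ∀ t ∈ Icc 0 T, 1 - x t ^ 2 - y t ^ 2 ≤ 0 := by
      refine nonpos_of_deriv (C := 0)
        (W' := fun t => 2 * x t * (b * (1 * x t ^ (2 * n + 1) - x t))) (by fun_prop) ?_ ?_ ?_
      · intro t ht
        have h1 := htrue T hnn t (Ioo_subset_Icc_self ht)
        refine (((h1.1.pow 2).const_sub 1).sub (h1.2.pow 2)).congr_deriv ?_
        push_cast
        ring
      · intro t ht hW
        have hx1 := hnn t (Ioo_subset_Icc_self ht)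
        have hx2 : x t ≤ 1 := by nlinarith [sq_nonneg (y t)]
        have := odd_pow_le (n := n) hx1 hx2
        have h3 : 0 ≤ 2 * x t * b := by positivity
        nlinarith
      · rw [hx0, hy0]
        nlinarith [hα.1]
    have hyT : 1 ≤ - y T := by
      have := hdisk T hT'
      rw [hxT] at this
      nlinarith
    refine ⟨- y T, ⟨hyT, by linarith [(hbox T hnn T hT').2.1]⟩, T, x, y,
      ⟨hT, htrue T hnn, hx0, hy0, hxT, by ring, hpos⟩, h, hbox' T hnn⟩
  · exfalso
    push Not at hex
    have hnn : ∀ s, ∀ t ∈ Icc 0 s, 0 ≤ x t := by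
      intro s t ht
      rcases ht.1.eq_or_lt with h | h
      · rw [← h, hx0]
      · exact (hex t h).le
    have hB : ∀ t, 0 ≤ t → x t ≤ D ∧ -A ≤ y t ∧ y t ≤ A :=
      fun t ht => hbox t (hnn t) t ⟨ht, le_refl _⟩
    have hode : ∀ t, 0 ≤ t → HasDerivAt x (y t - b * (1 * (x t) ^ (2 * n + 1) - x t)) t ∧
      HasDerivAt y (-x t) t := fun t ht => htrue t (hnn t) t ⟨ht, le_refl _⟩
    by_cases hy : ∀ t, 0 ≤ t → 0 ≤ y t
    · obtain ⟨δ, hδ, hδ1, hδx⟩ : ∃ δ > 0, δ ≤ 1 ∧ δ ≤ x 1 :=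
        ⟨min 1 (x 1), lt_min one_pos (hex 1 one_pos), min_le_left _ _, min_le_right _ _⟩
      have hge : ∀ t, 1 ≤ t → δ ≤ x t := by
        intro t ht
        have := nonpos_of_deriv (W := fun u => δ - x u)
          (W' := fun t => -(y t - b * (1 * (x t) ^ (2 * n + 1) - x t)))
          (C := 0) (s := 1) (T := t) (by fun_prop)
          (fun u hu => (hode u (by linarith [hu.1])).1.const_sub δ) ?_ (by linarith) t
          ⟨ht, le_refl _⟩
        · linarith
        · intro u hu hpos
          have hx1 := hex u (by linarith [hu.1])
          have hy1 := hy u (by linarith [hu.1])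
          have := odd_pow_le (n := n) hx1.le (by linarith)
          nlinarith
      have := le_of_deriv_le (f := y) (f' := fun t => - x t) (c := -δ) (s := 1)
        (T := 1 + (A + 1) / δ) (by have : 0 < (A + 1) / δ := by positivity
                                   linarith)
        (fun t ht => (hode t (by linarith [ht.1])).2) (fun t ht => by linarith [hge t ht.1])
      have h1 := (hB 1 zero_le_one).2.2
      have h2 := hy (1 + (A + 1) / δ) (by positivity)
      have h3 : -δ * (1 + (A + 1) / δ - 1) = -(A + 1) := by field_simp; ring
      rw [h3] at this
      linarith
    · push Not at hy
      obtain ⟨t₁, ht₁, hyt₁⟩ := hy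
      have hyle : ∀ t, t₁ ≤ t → y t ≤ y t₁ := by
        intro t ht
        have := le_of_deriv_le (f := y) (f' := fun t => - x t) (c := 0) ht
          (fun u hu => (hode u (by linarith [hu.1])).2)
          (fun u hu => by linarith [hnn u u ⟨by linarith [hu.1], le_refl _⟩])
        linarith
      set ε := - y t₁ with hε
      have hεp : 0 < ε := by linarith
      set C := x t₁ + b * y t₁ + b * A + 1 with hC
      have hC0 : 0 < C := by
        have h1 := hnn t₁ t₁ ⟨ht₁, le_refl _⟩
        have h2 := (hB t₁ ht₁).2.1
        nlinarith
      have hT : t₁ ≤ t₁ + C / ε := by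
        have : 0 < C / ε := by positivity
        linarith
      have := le_of_deriv_le (f := fun t => x t + b * y t) (c := -ε) hT
        (fun u hu => (hode u (by linarith [hu.1])).1.add
          ((hode u (by linarith [hu.1])).2.const_mul b)) ?_
      · have h3 : -ε * (t₁ + C / ε - t₁) = - C := by field_simp; ring
        rw [h3] at this
        have h1 := hnn (t₁ + C / ε) (t₁ + C / ε) ⟨by linarith, le_refl _⟩
        have h2 := (hB (t₁ + C / ε) (by linarith)).2.1
        have h4 := mul_le_mul_of_nonneg_left h2 hb.le
        linarith
      · intro u hu
        have h1 := hyle u hu.1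
        have h2 : 0 ≤ b * x u ^ (2 * n + 1) :=
          mul_nonneg hb.le (pow_nonneg (hnn u u ⟨by linarith [hu.1], le_refl _⟩) _)
        nlinarith

lemma exists_periodic {n : ℕ} (hn : 0 < n) {b : ℝ} (hb : 0 < b) :
    ∃ Γ, IsPeriodicOrbitLienard n (-b) Γ := by
  obtain ⟨D, hD⟩ : ∃ D, D = 1 + 4 / b + b := ⟨_, rfl⟩
  obtain ⟨A, hA⟩ : ∃ A, A = 4 * D := ⟨_, rfl⟩
  have hb4 : 0 < 4 / b := by positivity
  have hA1 : 1 ≤ A := by linarith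
  have hA0 : 0 ≤ A := by linarith
  choose! P hP T x y harc hsol hbd using
    fun (α : ℝ) (hα : α ∈ Icc 1 A) => exists_arc hn hb hD hA hα
  have hmono : ∀ α ∈ Icc 1 A, ∀ α' ∈ Icc 1 A, α ≤ α' → P α ≤ P α' := by
    intro α hα α' hα' hle
    by_contra hcon
    push Not at hcon
    have := (arc_compare (harc α' hα') (harc α hα) hb zero_le_one le_rfl
      (by linarith [hα.1]) (by linarith [(hP α' hα').1]) hle hcon.le).2.2
    linarith
  obtain ⟨σ, hσ, hfix⟩ : ∃ σ ∈ Icc 1 A, P σ = σ := by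
    set S := {α | α ∈ Icc 1 A ∧ α ≤ P α} with hS
    have h1S : (1 : ℝ) ∈ S := ⟨⟨le_refl _, hA1⟩, (hP 1 ⟨le_refl _, hA1⟩).1⟩
    have hbS : BddAbove S := ⟨A, fun α hα => hα.1.2⟩
    have hσ : sSup S ∈ Icc 1 A := ⟨le_csSup hbS h1S, csSup_le ⟨1, h1S⟩ fun α hα => hα.1.2⟩
    refine ⟨sSup S, hσ, ?_⟩
    have h1 : sSup S ≤ P (sSup S) := csSup_le ⟨1, h1S⟩ fun α hα =>
      hα.2.trans (hmono α hα.1 _ hσ (le_csSup hbS hα))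
    exact le_antisymm (le_csSup hbS ⟨hP _ hσ, hmono _ hσ _ (hP _ hσ) h1⟩) h1
  have ha := harc σ hσ
  have hs := hsol σ hσ
  have hbx := hbd σ hσ
  rw [hfix] at ha
  generalize T σ = τ at *
  generalize x σ = X at *
  generalize y σ = Y at *
  obtain ⟨hτ, -, hx0, hy0, hxT, hyT, -⟩ := ha
  have hanti := TSol.unique hA0 (hs.shift τ) (hs.neg hA0) (t₀ := 0) (by simp [hxT, hx0])
    (by simp [hyT, hy0])
  have hXa : ∀ t, X (t + τ) = - X t := congrFun hanti.1
  have hYa : ∀ t, Y (t + τ) = - Y t := congrFun hanti.2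
  have hXb : ∀ t, |X t| ≤ A := by
    intro t
    have hp : Function.Periodic (fun t => |X t|) τ := fun t => by simp [hXa]
    obtain ⟨u, hu, hut⟩ := hp.exists_mem_Ico₀ hτ t
    rw [hut]
    exact (hbx u (Ico_subset_Icc_self hu)).1
  have hYb : ∀ t, |Y t| ≤ A := by
    intro t
    have hp : Function.Periodic (fun t => |Y t|) τ := fun t => by simp [hYa]
    obtain ⟨u, hu, hut⟩ := hp.exists_mem_Ico₀ hτ t
    rw [hut]
    exact (hbx u (Ico_subset_Icc_self hu)).2
  refine ⟨_, X, Y, ?_, ⟨0, τ, ?_⟩, ⟨2 * τ, by linarith, fun t => ?_⟩, rfl⟩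
  · intro t
    have := hs t
    rw [clampR_of_abs (hXb t), clampR_of_abs (hYb t)] at this
    refine ⟨this.1.congr_deriv (by ring), this.2⟩
  · rw [hy0, hyT]
    intro h
    have := congrArg Prod.snd h
    simp only at this
    linarith [hσ.1]
  · rw [two_mul, ← add_assoc, hXa, hXa, hYa, hYa, neg_neg, neg_neg]

lemma IsSolLienard.negate {n : ℕ} {a : ℝ} {x y : ℝ → ℝ} (h : IsSolLienard n a x y) :
    IsSolLienard n a (fun t => - x t) (fun t => - y t) := by
  have he : Even (2 * n) := even_two_mul n
  intro t
  refine ⟨(h t).1.neg.congr_deriv ?_, (h t).2.neg⟩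
  simp only [he.neg_pow]
  ring

lemma IsSolLienard.arc {n : ℕ} {b : ℝ} {x y : ℝ → ℝ} (h : IsSolLienard n (-b) x y) {t₀ t₁ : ℝ}
    (ht : t₀ < t₁) (h0 : x t₀ = 0) (h1 : x t₁ = 0) (hpos : ∀ t ∈ Ioo t₀ t₁, 0 < x t) :
    IsArc n b 1 (y t₀) (-y t₁) (t₁ - t₀) (fun t => x (t + t₀)) (fun t => y (t + t₀)) := by
  refine ⟨by linarith, fun t _ => ⟨?_, ?_⟩, by simp [h0], by simp, by simp [h1], by simp,
    fun t ht' => hpos _ ⟨by linarith [ht'.1], by linarith [ht'.2]⟩⟩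
  · exact ((h (t + t₀)).1.comp_add_const t t₀).congr_deriv (by ring)
  · exact (h (t + t₀)).2.comp_add_const t t₀

lemma periodic_max {f : ℝ → ℝ} {T : ℝ} (hT : 0 < T) (hc : Continuous f)
    (hp : Function.Periodic f T) : ∃ t₀, ∀ t, f t ≤ f t₀ := by
  obtain ⟨t₀, -, h⟩ := (isCompact_Icc (a := 0) (b := T)).exists_isMaxOn
    (nonempty_Icc.2 hT.le) hc.continuousOn
  refine ⟨t₀, fun t => ?_⟩
  obtain ⟨u, hu, hut⟩ := hp.exists_mem_Ico₀ hT t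
  rw [hut]
  exact h (Ico_subset_Icc_self hu)

lemma IsSolLienard.contx {n : ℕ} {a : ℝ} {x y : ℝ → ℝ} (h : IsSolLienard n a x y) :
    Continuous x := continuous_iff_continuousAt.2 fun t => (h t).1.continuousAt

lemma IsSolLienard.conty {n : ℕ} {a : ℝ} {x y : ℝ → ℝ} (h : IsSolLienard n a x y) :
    Continuous y := continuous_iff_continuousAt.2 fun t => (h t).2.continuousAt

lemma IsSolLienard.tsol {n : ℕ} {b : ℝ} {x y : ℝ → ℝ} (h : IsSolLienard n (-b) x y) {T : ℝ}
    (hT : 0 < T) (hx : Function.Periodic x T) (hy : Function.Periodic y T) :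
    ∃ R₀, 0 ≤ R₀ ∧ ∀ R, R₀ ≤ R → TSol n b R x y := by
  obtain ⟨s, hs⟩ := periodic_max hT h.contx.abs (fun t => by simp [hx t])
  obtain ⟨u, hu⟩ := periodic_max hT h.conty.abs (fun t => by simp [hy t])
  refine ⟨max |x s| |y u|, le_max_of_le_left (abs_nonneg _), fun R hR t => ?_⟩
  rw [clampR_of_abs (((hs t).trans (le_max_left _ _)).trans hR),
    clampR_of_abs (((hu t).trans (le_max_right _ _)).trans hR)]
  exact ⟨(h t).1.congr_deriv (by ring), (h t).2⟩

lemma TSol.zero (n : ℕ) (b : ℝ) {R : ℝ} (hR : 0 ≤ R) : TSol n b R (fun _ => 0) (fun _ => 0) := by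
  intro t
  rw [clampR_of_abs (by simpa using hR)]
  simpa using hasDerivAt_const t (0 : ℝ)

lemma periodic_core {n : ℕ} {b : ℝ} (hb : 0 < b) {x y : ℝ → ℝ} (h : IsSolLienard n (-b) x y)
    (hnc : ∃ t₁ t₂ : ℝ, (x t₁, y t₁) ≠ (x t₂, y t₂)) {T : ℝ}
    (hT : 0 < T) (hx : Function.Periodic x T) (hy : Function.Periodic y T) {t₀ : ℝ}
    (hmax : ∀ t, |y t| ≤ y t₀) :
    0 < y t₀ ∧ x t₀ = 0 ∧ ∃ t₁, x t₁ = 0 ∧ y t₁ = - y t₀ ∧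
      ∃ T' x' y', IsArc n b 1 (y t₀) (y t₀) T' x' y' := by
  have hx0 : x t₀ = 0 := by
    have hl : IsLocalMax y t₀ := Eventually.of_forall fun t => (le_abs_self _).trans (hmax t)
    have := hl.hasDerivAt_eq_zero (h t₀).2
    linarith
  have hnz : ∀ t, x t = 0 → y t ≠ 0 := by
    intro t h1 h2
    obtain ⟨R, hR, hsol⟩ := h.tsol hT hx hy
    obtain ⟨e1, e2⟩ := TSol.unique hR (hsol R le_rfl) (TSol.zero n b hR) (t₀ := t) h1 h2
    obtain ⟨s, u, hsu⟩ := hnc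
    apply hsu
    rw [e1, e2]
  have hM : 0 < y t₀ :=
    lt_of_le_of_ne ((abs_nonneg _).trans (hmax t₀)) (hnz t₀ hx0).symm
  have hdz : ∀ t, x t = 0 → HasDerivAt x (y t) t := by
    intro t ht
    have := (h t).1
    rw [ht] at this
    simpa using this
  obtain ⟨t₁, ht₁, -, hxt₁, hpos⟩ := first_zero h.contx (hdz t₀ hx0) hx0 hM
    (show t₀ < t₀ + T by linarith) (by rw [hx, hx0])
  have hyt₁ : y t₁ < 0 := by
    refine lt_of_le_of_ne ?_ (hnz t₁ hxt₁)
    by_contra hcon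
    push Not at hcon
    obtain ⟨ε, hε, hneg⟩ := neg_left (hdz t₁ hxt₁) hxt₁ hcon
    have hm : max ((t₀ + t₁) / 2) (t₁ - ε / 2) < t₁ := max_lt (by linarith) (by linarith)
    have := hneg _ ⟨lt_max_of_lt_right (by linarith), hm⟩
    have := hpos _ ⟨lt_max_of_lt_left (by linarith), hm⟩
    linarith
  have hrev : HasDerivAt (fun t => - x (-t)) (y t₀) (-t₀) := by
    have h' : HasDerivAt x (y t₀) (-(-t₀)) := by rw [neg_neg]; exact hdz t₀ hx0
    have := (h'.comp (-t₀) (hasDerivAt_neg (-t₀))).neg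
    refine this.congr_deriv (by ring)
  obtain ⟨r, hr, -, hxr, hposr⟩ := first_zero (x := fun t => - x (-t)) (t₂ := -t₀ + T)
    (h.contx.comp continuous_neg).neg hrev (by simp [hx0]) hM (by linarith)
    (by
      have : x (-(-t₀ + T)) = x t₀ := by
        rw [← hx (-(-t₀ + T))]
        congr 1
        ring
      change - x (-(-t₀ + T)) ≤ 0
      rw [this, hx0]; simp)
  have hxm : x (-r) = 0 := by simpa using hxr
  have hneg : ∀ t ∈ Ioo (-r) t₀, 0 < - x t := by
    intro t ht
    have := hposr (-t) ⟨by linarith [ht.2], by linarith [ht.1]⟩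
    rwa [neg_neg] at this
  have hym : y (-r) < 0 := by
    refine lt_of_le_of_ne ?_ (hnz _ hxm)
    by_contra hcon
    push Not at hcon
    obtain ⟨ε, hε, hp⟩ := pos_right (hdz _ hxm) hxm hcon
    have hm : -r < min ((t₀ + -r) / 2) (-r + ε / 2) := lt_min (by linarith) (by linarith)
    have := hp _ ⟨hm, min_lt_of_right_lt (by linarith)⟩
    have := hneg _ ⟨hm, min_lt_of_left_lt (by linarith)⟩
    linarith
  have harc1 := h.arc ht₁ hx0 hxt₁ hpos
  have harc2 := h.negate.arc (t₀ := -r) (t₁ := t₀) (by linarith) (by simp [hxm]) (by simp [hx0]) hneg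
  have := arc_compare harc1 harc2 hb zero_le_one le_rfl (by linarith) (by linarith)
    ((neg_le_abs _).trans (hmax _)) (by rw [neg_neg]; exact (neg_le_abs _).trans (hmax _))
  rw [neg_neg] at this
  have e := this.2.2
  rw [e] at harc1
  exact ⟨hM, hx0, t₁, hxt₁, by linarith, _, _, _, harc1⟩

lemma periodic_arc {n : ℕ} {b : ℝ} (hb : 0 < b) {x y : ℝ → ℝ} (h : IsSolLienard n (-b) x y)
    (hnc : ∃ t₁ t₂ : ℝ, (x t₁, y t₁) ≠ (x t₂, y t₂)) {T : ℝ}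
    (hT : 0 < T) (hx : Function.Periodic x T) (hy : Function.Periodic y T) :
    ∃ t₀, 0 < y t₀ ∧ x t₀ = 0 ∧ ∃ T' x' y', IsArc n b 1 (y t₀) (y t₀) T' x' y' := by
  obtain ⟨t₀, ht₀⟩ := periodic_max hT h.conty.abs (fun t => by simp [hy t])
  rcases le_total 0 (y t₀) with h0 | h0
  · rw [abs_of_nonneg h0] at ht₀
    obtain ⟨h1, h2, t₁, h3, h4, h5⟩ := periodic_core hb h hnc hT hx hy ht₀
    exact ⟨t₀, h1, h2, h5⟩
  · rw [abs_of_nonpos h0] at ht₀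
    obtain ⟨h1, h2, t₁, h3, h4, h5⟩ := periodic_core hb h.negate (t₀ := t₀)
      (by
        obtain ⟨s, u, hsu⟩ := hnc
        refine ⟨s, u, fun e => hsu ?_⟩
        simpa using e) hT (fun t => by simp [hx t]) (fun t => by simp [hy t])
      (fun t => by rw [abs_neg]; exact ht₀ t)
    rw [neg_neg] at h4
    have h6 : y t₁ = - y t₀ := by linarith
    refine ⟨t₁, by rw [h6]; exact h1, by simpa using h3, ?_⟩
    rw [h6]
    exact h5

lemma IsArc.scale {n : ℕ} {b c α β T : ℝ} {x y : ℝ → ℝ} (h : IsArc n b c α β T x y) {l : ℝ}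
    (hl : 0 < l) :
    IsArc n b (c / l ^ (2 * n)) (l * α) (l * β) T (fun t => l * x t) (fun t => l * y t) := by
  obtain ⟨hT, hd, hx0, hy0, hxT, hyT, hpos⟩ := h
  refine ⟨hT, fun t ht => ⟨?_, ?_⟩, by simp [hx0], by simp [hy0], by simp [hxT], by simp [hyT],
    fun t ht => mul_pos hl (hpos t ht)⟩
  · refine ((hd t ht).1.const_mul l).congr_deriv ?_
    have : l ^ (2 * n) ≠ 0 := by positivity
    rw [mul_pow, pow_succ l]
    field_simp
  · refine ((hd t ht).2.const_mul l).congr_deriv ?_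
    ring

lemma arc_fixed_le {n : ℕ} (hn : 0 < n) {b M₁ M₂ T₁ T₂ : ℝ} (hb : 0 < b) {x₁ y₁ x₂ y₂ : ℝ → ℝ}
    (h₁ : IsArc n b 1 M₁ M₁ T₁ x₁ y₁) (h₂ : IsArc n b 1 M₂ M₂ T₂ x₂ y₂)
    (hM₁ : 0 < M₁) (hM₂ : 0 < M₂) : M₂ ≤ M₁ := by
  by_contra hcon
  push Not at hcon
  have hl : 1 < M₂ / M₁ := (one_lt_div hM₁).2 hcon
  have hs := h₁.scale (l := M₂ / M₁) (by linarith)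
  rw [div_mul_cancel₀ _ hM₁.ne'] at hs
  have hp : 1 < (M₂ / M₁) ^ (2 * n) := one_lt_pow₀ hl (by omega)
  have hlt : 1 / (M₂ / M₁) ^ (2 * n) < 1 := (div_lt_one (by linarith)).2 hp
  have := (arc_compare hs h₂ hb (by positivity) hlt.le hM₂ hM₂ le_rfl le_rfl).1
  linarith

lemma unique_periodic {n : ℕ} (hn : 0 < n) {b : ℝ} (hb : 0 < b) {Γ₁ Γ₂ : Set (ℝ × ℝ)}
    (h₁ : IsPeriodicOrbitLienard n (-b) Γ₁) (h₂ : IsPeriodicOrbitLienard n (-b) Γ₂) : Γ₁ = Γ₂ := by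
  obtain ⟨x₁, y₁, hs₁, hnc₁, ⟨T₁, hT₁, hp₁⟩, rfl⟩ := h₁
  obtain ⟨x₂, y₂, hs₂, hnc₂, ⟨T₂, hT₂, hp₂⟩, rfl⟩ := h₂
  have px₁ : Function.Periodic x₁ T₁ := fun t => congrArg Prod.fst (hp₁ t)
  have py₁ : Function.Periodic y₁ T₁ := fun t => congrArg Prod.snd (hp₁ t)
  have px₂ : Function.Periodic x₂ T₂ := fun t => congrArg Prod.fst (hp₂ t)
  have py₂ : Function.Periodic y₂ T₂ := fun t => congrArg Prod.snd (hp₂ t)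
  obtain ⟨s₁, hM₁, hx₁, _, _, _, ha₁⟩ := periodic_arc hb hs₁ hnc₁ hT₁ px₁ py₁
  obtain ⟨s₂, hM₂, hx₂, _, _, _, ha₂⟩ := periodic_arc hb hs₂ hnc₂ hT₂ px₂ py₂
  have hM : y₁ s₁ = y₂ s₂ := le_antisymm (arc_fixed_le hn hb ha₂ ha₁ hM₂ hM₁)
    (arc_fixed_le hn hb ha₁ ha₂ hM₁ hM₂)
  obtain ⟨R₁, hR₁, ht₁⟩ := hs₁.tsol hT₁ px₁ py₁
  obtain ⟨R₂, hR₂, ht₂⟩ := hs₂.tsol hT₂ px₂ py₂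
  obtain ⟨e1, e2⟩ := TSol.unique (hR₁.trans (le_max_left R₁ R₂))
    ((ht₁ _ (le_max_left R₁ R₂)).shift s₁) ((ht₂ _ (le_max_right R₁ R₂)).shift s₂) (t₀ := 0)
    (by simp [hx₁, hx₂]) (by simp [hM])
  have e1' : ∀ t, x₁ (t + s₁) = x₂ (t + s₂) := congrFun e1
  have e2' : ∀ t, y₁ (t + s₁) = y₂ (t + s₂) := congrFun e2
  ext p
  constructor
  · rintro ⟨t, rfl⟩
    refine ⟨t - s₁ + s₂, ?_⟩
    simp only [← e1', ← e2', sub_add_cancel]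
  · rintro ⟨t, rfl⟩
    refine ⟨t - s₂ + s₁, ?_⟩
    simp only [e1', e2', sub_add_cancel]

lemma periodic_reflect {n : ℕ} {a : ℝ} {Γ : Set (ℝ × ℝ)} (h : IsPeriodicOrbitLienard n a Γ) :
    IsPeriodicOrbitLienard n (-a) ((fun p : ℝ × ℝ => (p.1, -p.2)) '' Γ) := by
  obtain ⟨x, y, hs, ⟨t₁, t₂, hne⟩, ⟨T, hT, hp⟩, rfl⟩ := h
  refine ⟨fun t => x (-t), fun t => - y (-t), ?_, ⟨-t₁, -t₂, ?_⟩, ⟨T, hT, ?_⟩, ?_⟩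
  · intro t
    have h1 := (hs (-t)).1.comp t (hasDerivAt_neg t)
    have h2 := ((hs (-t)).2.comp t (hasDerivAt_neg t)).neg
    exact ⟨h1.congr_deriv (by ring), h2.congr_deriv (by ring)⟩
  · intro e
    apply hne
    simpa using e
  · intro t
    have := hp (-(t + T))
    have e : -(t + T) + T = -t := by ring
    rw [e] at this
    simp only [Prod.mk.injEq] at this ⊢
    exact ⟨this.1.symm, by rw [this.2]⟩
  · ext p
    constructor
    · rintro ⟨_, ⟨t, rfl⟩, rfl⟩
      exact ⟨-t, by simp⟩
    · rintro ⟨t, rfl⟩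
      exact ⟨_, ⟨-t, rfl⟩, rfl⟩

lemma periodic_existsUnique {n : ℕ} (hn : 0 < n) {a : ℝ} (ha : a ≠ 0) :
    (∃ Γ, IsPeriodicOrbitLienard n a Γ) ∧
    ∀ Γ₁ Γ₂, IsPeriodicOrbitLienard n a Γ₁ → IsPeriodicOrbitLienard n a Γ₂ → Γ₁ = Γ₂ := by
  rcases lt_or_gt_of_ne ha with h | h
  · have hb : 0 < -a := by linarith
    have h1 := exists_periodic hn hb
    rw [neg_neg] at h1
    refine ⟨h1, fun Γ₁ Γ₂ h₁ h₂ => ?_⟩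
    exact unique_periodic hn hb (by rwa [neg_neg]) (by rwa [neg_neg])
  · obtain ⟨Γ, hΓ⟩ := exists_periodic hn h
    have hr := periodic_reflect hΓ
    rw [neg_neg] at hr
    refine ⟨⟨_, hr⟩, fun Γ₁ Γ₂ h₁ h₂ => ?_⟩
    have := unique_periodic hn h (periodic_reflect h₁) (periodic_reflect h₂)
    refine Set.image_injective.2 ?_ this
    rintro ⟨p, q⟩ ⟨p', q'⟩ e
    simpa using e

/-- For every positive integer `n` and every real `a ≠ 0`, the Liénard system `L_a`
has exactly one limit cycle. -/
theorem lienard_unique_limit_cycle (n : ℕ) (hn : 0 < n) (a : ℝ) (ha : a ≠ 0) :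
    (∃ Γ : Set (ℝ × ℝ), IsLimitCycleLienard n a Γ) ∧
    ∀ Γ₁ Γ₂ : Set (ℝ × ℝ),
      IsLimitCycleLienard n a Γ₁ → IsLimitCycleLienard n a Γ₂ → Γ₁ = Γ₂ := by
  obtain ⟨⟨Γ, hΓ⟩, huniq⟩ := periodic_existsUnique hn ha
  refine ⟨⟨Γ, hΓ, Set.univ, isOpen_univ, Set.subset_univ _, fun Γ' h' _ => huniq Γ' Γ h' hΓ⟩, ?_⟩
  intro Γ₁ Γ₂ h₁ h₂
  exact huniq Γ₁ Γ₂ h₁.1 h₂.1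
end
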